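/- arXiv:2507.10965 — 3 statements merged into one kernel-verified Lean document; each statement's English description precedes it below -/
import Mathlib

section
/- For every natural number n, the number of quadruples (μ₁, μ₂, ν₁, ν₂), where μ₁ and μ₂ are partitions into distinct odd parts, ν₁ and ν₂ are partitions into distinct parts, and |μ₁| + |μ₂| + |ν₁| + |ν₂| = 2n, equals the number of octuples (μ₁, μ₂, μ₃, μ₄, ν₁, ν₂, ν₃, ν₄), where μ₁, μ₂, μ₃, μ₄ are partitions into distinct odd parts, ν₁, ν₂, ν₃, ν₄ are partitions into distinct parts, and the total weight |μ₁| + |μ₂| + |μ₃| + |μ₄| + |ν₁| + |ν₂| + |ν₃| + |ν₄| equals n. -/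
/-- A partition into distinct odd parts, encoded as a multiset of naturals. -/
def DistinctOddPartition (mu : Multiset ℕ) : Prop :=
  (∀ i ∈ mu, Odd i) ∧ mu.Nodup

/-- A partition into distinct (positive) parts, encoded as a multiset of naturals. -/
def DistinctPartition (nu : Multiset ℕ) : Prop :=
  (∀ i ∈ nu, 0 < i) ∧ nu.Nodup

open PowerSeries Finset

/-- Truncation of `∏ (1 + q ^ (2 i + 1))`. -/
noncomputable def oddProd (N : ℕ) : ℤ⟦X⟧ := ∏ i ∈ range N, (1 + X ^ (2 * i + 1))

/-- Truncation of `∏ (1 + q ^ (i + 1))`. -/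
noncomputable def distinctProd (N : ℕ) : ℤ⟦X⟧ := ∏ i ∈ range N, (1 + X ^ (i + 1))

theorem prod_one_add_X_pow_pow (S : Finset ℕ) (K : ℕ) :
    (∏ i ∈ S, (1 + X ^ i : ℤ⟦X⟧)) ^ K =
      ∑ f ∈ Fintype.piFinset (fun _ : Fin K => S.powerset), X ^ (∑ k, ∑ i ∈ f k, i) := by
  have h : (∏ i ∈ S, (1 + X ^ i : ℤ⟦X⟧)) ^ K =
      ∏ _k : Fin K, ∑ t ∈ S.powerset, (X : ℤ⟦X⟧) ^ (∑ i ∈ t, i) := by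
    simp_rw [prod_one_add, prod_pow_eq_pow_sum _ (fun i => i)]
    simp
  rw [h, prod_univ_sum]
  simp [prod_pow_eq_pow_sum]

theorem oddProd_eq (N : ℕ) :
    oddProd N = ∏ i ∈ (range N).image (fun i => 2 * i + 1), (1 + X ^ i : ℤ⟦X⟧) := by
  rw [prod_image (by intro a _ b _ h; simpa using h)]; rfl

theorem distinctProd_eq (N : ℕ) :
    distinctProd N = ∏ i ∈ (range N).image (fun i => i + 1), (1 + X ^ i : ℤ⟦X⟧) := by
  rw [prod_image (by intro a _ b _ h; simpa using h)]; rfl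

theorem exists_subset_val_eq {μ : Multiset ℕ} (h : μ.Nodup) {S : Finset ℕ} (hS : ∀ i ∈ μ, i ∈ S) :
    ∃ s : Finset ℕ, s ⊆ S ∧ s.val = μ :=
  ⟨⟨μ, h⟩, fun i hi => hS i hi, rfl⟩

theorem card_tuples_eq_coeff (K n N : ℕ) (hN : n < N) :
    (Nat.card {q : (Fin K → Multiset ℕ) × (Fin K → Multiset ℕ) //
      (∀ k, DistinctOddPartition (q.1 k)) ∧ (∀ k, DistinctPartition (q.2 k)) ∧
      (∑ k, (q.1 k).sum) + (∑ k, (q.2 k).sum) = n} : ℤ) =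
    coeff n ((oddProd N * distinctProd N) ^ K) := by
  classical
  set S := (range N).image (fun i => 2 * i + 1) with hS
  set T := (range N).image (fun i => i + 1) with hT
  set U := (Fintype.piFinset (fun _ : Fin K => S.powerset) ×ˢ
    Fintype.piFinset (fun _ : Fin K => T.powerset)).filter
      (fun p => (∑ k, ∑ i ∈ p.1 k, i) + (∑ k, ∑ i ∈ p.2 k, i) = n) with hU
  have hinj : Function.Injective (fun p : (Fin K → Finset ℕ) × (Fin K → Finset ℕ) =>
      ((fun k => (p.1 k).val, fun k => (p.2 k).val) :
        (Fin K → Multiset ℕ) × (Fin K → Multiset ℕ))) := by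
    rintro ⟨a, b⟩ ⟨c, d⟩ h
    simp only [Prod.mk.injEq, funext_iff, Finset.val_inj] at h
    exact Prod.ext (funext h.1) (funext h.2)
  have hsum : ∀ s : Finset ℕ, s.val.sum = ∑ i ∈ s, i := fun s => by rw [Finset.sum, Multiset.map_id']
  rw [Nat.subtype_card (U.map ⟨_, hinj⟩), card_map]
  · rw [mul_pow, oddProd_eq, distinctProd_eq, prod_one_add_X_pow_pow, prod_one_add_X_pow_pow,
      sum_mul_sum, ← sum_product', hU, card_filter]
    simp only [← pow_add, map_sum, coeff_X_pow]
    push_cast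
    refine sum_congr rfl fun p _ => ?_
    simp only [eq_comm]
  · rintro ⟨μ, ν⟩
    simp only [mem_map, Function.Embedding.coeFn_mk, Prod.mk.injEq]
    constructor
    · rintro ⟨⟨f, g⟩, hp, rfl, rfl⟩
      simp only [hU, mem_filter, mem_product, Fintype.mem_piFinset, mem_powerset] at hp
      obtain ⟨⟨hf, hg⟩, hs⟩ := hp
      refine ⟨fun k => ⟨fun i hi => ?_, (f k).nodup⟩, fun k => ⟨fun i hi => ?_, (g k).nodup⟩, ?_⟩
      · have := hf k hi
        simp only [hS, mem_image] at this
        obtain ⟨a, -, rfl⟩ := this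
        exact odd_two_mul_add_one a
      · have := hg k hi
        simp only [hT, mem_image] at this
        obtain ⟨a, -, rfl⟩ := this
        exact Nat.succ_pos a
      · simpa only [hsum] using hs
    · rintro ⟨h1, h2, h3⟩
      have hf : ∀ k, ∃ s : Finset ℕ, s ⊆ S ∧ s.val = μ k := fun k => by
        refine exists_subset_val_eq (h1 k).2 fun i hi => ?_
        obtain ⟨a, rfl⟩ := (h1 k).1 i hi
        have l1 := Multiset.le_sum_of_mem hi
        have l2 := single_le_sum (f := fun k => (μ k).sum) (fun _ _ => Nat.zero_le _) (mem_univ k)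
        simp only [hS, mem_image, mem_range]
        exact ⟨a, by omega, rfl⟩
      have hg : ∀ k, ∃ s : Finset ℕ, s ⊆ T ∧ s.val = ν k := fun k => by
        refine exists_subset_val_eq (h2 k).2 fun i hi => ?_
        have l0 := (h2 k).1 i hi
        have l1 := Multiset.le_sum_of_mem hi
        have l2 := single_le_sum (f := fun k => (ν k).sum) (fun _ _ => Nat.zero_le _) (mem_univ k)
        simp only [hT, mem_image, mem_range]
        exact ⟨i - 1, by omega, by omega⟩
      choose f hf hf' using hf
      choose g hg hg' using hg
      refine ⟨(f, g), ?_, funext hf', funext hg'⟩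
      simp only [hU, mem_filter, mem_product, Fintype.mem_piFinset, mem_powerset]
      refine ⟨⟨hf, hg⟩, ?_⟩
      simp only [← hsum, hf', hg']
      exact h3

/-- The theta series `∑ q ^ (j ^ 2)` over all integers `j`. -/
noncomputable def thetaSeries : ℤ⟦X⟧ :=
  PowerSeries.mk fun n => ∑ j ∈ Icc (-(n : ℤ)) n, if j.natAbs ^ 2 = n then 1 else 0

/-- Truncation of the theta series to `|j| ≤ N`. -/
noncomputable def thetaSum (N : ℕ) : ℤ⟦X⟧ := ∑ j ∈ Icc (-(N : ℤ)) N, X ^ (j.natAbs ^ 2)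

theorem coeff_thetaSum {n N : ℕ} (h : n ≤ N) : coeff n (thetaSum N) = coeff n thetaSeries := by
  simp only [thetaSum, thetaSeries, map_sum, coeff_X_pow, coeff_mk]
  symm
  rw [sum_congr rfl fun j _ => if_congr (eq_comm (b := n)) rfl rfl]
  refine sum_subset (fun j hj => ?_) fun j hj hj' => ?_
  · simp only [mem_Icc] at hj ⊢; omega
  · rw [if_neg]
    rintro rfl
    apply hj'
    have := Nat.le_self_pow two_ne_zero j.natAbs
    simp only [mem_Icc]
    omega

theorem X_pow_dvd_thetaSeries_sub (N : ℕ) : (X : ℤ⟦X⟧) ^ (N + 1) ∣ thetaSeries - thetaSum N := by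
  rw [X_pow_dvd_iff]
  intro m hm
  rw [map_sub, coeff_thetaSum (by omega), sub_self]

theorem X_pow_dvd_rescale {k : ℕ} {f : ℤ⟦X⟧} (ε : ℤ) (h : X ^ k ∣ f) :
    (X : ℤ⟦X⟧) ^ k ∣ rescale ε f := by
  rw [X_pow_dvd_iff] at h ⊢
  intro m hm
  rw [coeff_rescale, h m hm, mul_zero]

/-- Representations of `n` as an ordered sum of two integer squares. -/
noncomputable def sumTwoSquares (n : ℕ) : Finset (ℤ × ℤ) :=
  (Icc (-(n : ℤ)) n ×ˢ Icc (-(n : ℤ)) n).filter fun p => p.1.natAbs ^ 2 + p.2.natAbs ^ 2 = n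

theorem mem_sumTwoSquares {n : ℕ} {p : ℤ × ℤ} :
    p ∈ sumTwoSquares n ↔ p.1 ^ 2 + p.2 ^ 2 = n := by
  have h1 := Nat.le_self_pow two_ne_zero p.1.natAbs
  have h2 := Nat.le_self_pow two_ne_zero p.2.natAbs
  have key : p.1.natAbs ^ 2 + p.2.natAbs ^ 2 = n ↔ p.1 ^ 2 + p.2 ^ 2 = n := by
    zify; simp
  simp only [sumTwoSquares, mem_filter, mem_product, mem_Icc, ← key]
  refine ⟨fun h => h.2, fun h => ⟨?_, h⟩⟩
  omega

theorem coeff_theta_mul_rescale (ε : ℤ) (n : ℕ) :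
    coeff n (thetaSeries * rescale ε thetaSeries) =
      ∑ p ∈ sumTwoSquares n, ε ^ (p.2.natAbs ^ 2) := by
  have h : X ^ (n + 1) ∣ thetaSeries * rescale ε thetaSeries -
      thetaSum n * rescale ε (thetaSum n) := by
    have h1 := X_pow_dvd_thetaSeries_sub n
    have h2 := X_pow_dvd_rescale ε h1
    rw [map_sub] at h2
    exact dvd_mul_sub_mul h1 h2
  have h' := X_pow_dvd_iff.1 h n (Nat.lt_succ_self n)
  rw [map_sub, sub_eq_zero] at h'
  have h3 : rescale ε (thetaSum n) =
      ∑ j ∈ Icc (-(n : ℤ)) n, C (ε ^ (j.natAbs ^ 2)) * X ^ (j.natAbs ^ 2) := by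
    simp [thetaSum, rescale_X, mul_pow]
  rw [h', h3, thetaSum, sum_mul_sum, ← sum_product', map_sum, sumTwoSquares, sum_filter]
  refine sum_congr rfl fun p _ => ?_
  rw [mul_left_comm, ← pow_add, coeff_C_mul, coeff_X_pow]
  simp only [eq_comm (a := n), mul_ite, mul_one, mul_zero]

theorem sum_sumTwoSquares_two_mul (ε : ℤ) (hε : ε = 1 ∨ ε = -1) (m : ℕ) :
    ∑ p ∈ sumTwoSquares (2 * m), ε ^ (p.2.natAbs ^ 2) =
      ε ^ m * ∑ p ∈ sumTwoSquares m, (1 : ℤ) ^ (p.2.natAbs ^ 2) := by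
  rw [mul_sum]
  symm
  refine sum_nbij' (fun p => (p.1 + p.2, p.1 - p.2))
    (fun p => ((p.1 + p.2) / 2, (p.1 - p.2) / 2)) ?_ ?_ ?_ ?_ ?_
  · rintro ⟨x, y⟩ h
    rw [mem_sumTwoSquares] at h ⊢
    push_cast
    linear_combination 2 * h
  · rintro ⟨a, b⟩ h
    rw [mem_sumTwoSquares] at h ⊢
    push_cast at h
    simp only
    have he : Even (a + b) := by
      have : Even (a ^ 2 + b ^ 2) := ⟨m, by linarith⟩
      simpa [Int.even_add, Int.even_pow] using this
    obtain ⟨x, hx⟩ := he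
    obtain rfl : b = x + x - a := by linarith
    have e1 : (a + (x + x - a)) / 2 = x := by omega
    have e2 : (a - (x + x - a)) / 2 = a - x := by omega
    rw [e1, e2]
    linarith
  · rintro ⟨x, y⟩ -
    simp only [Prod.mk.injEq]
    omega
  · rintro ⟨a, b⟩ h
    rw [mem_sumTwoSquares] at h
    push_cast at h
    have he : Even (a + b) := by
      have : Even (a ^ 2 + b ^ 2) := ⟨m, by linarith⟩
      simpa [Int.even_add, Int.even_pow] using this
    obtain ⟨x, hx⟩ := he
    simp only [Prod.mk.injEq]
    omega
  · rintro ⟨x, y⟩ h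
    rw [mem_sumTwoSquares] at h
    simp only at h ⊢
    rcases hε with rfl | rfl
    · simp
    · rw [one_pow, mul_one]
      have : Even m ↔ Even ((x - y).natAbs ^ 2) := by
        rw [← Int.even_coe_nat, ← h, Nat.even_pow' two_ne_zero, Int.natAbs_even]
        simp [Int.even_add, Int.even_sub, Int.even_pow]
      rcases Nat.even_or_odd m with hm | hm
      · rw [hm.neg_one_pow, (this.1 hm).neg_one_pow]
      · rw [hm.neg_one_pow, Odd.neg_one_pow]
        rw [← Nat.not_even_iff_odd] at hm ⊢
        rwa [← this]

theorem rescale_neg_one_rescale_neg_one (f : ℤ⟦X⟧) : rescale (-1) (rescale (-1) f) = f := by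
  rw [rescale_rescale]; simp

theorem coeff_two_mul_theta_mul_rescale (ε : ℤ) (hε : ε = 1 ∨ ε = -1) (m : ℕ) :
    coeff (2 * m) (thetaSeries * rescale ε thetaSeries) =
      ε ^ m * coeff m (thetaSeries ^ 2) := by
  have h := coeff_theta_mul_rescale 1 m
  rw [rescale_one, RingHom.id_apply, ← sq] at h
  rw [coeff_theta_mul_rescale, h, sum_sumTwoSquares_two_mul ε hε]

theorem theta_mul_rescale_theta :
    thetaSeries * rescale (-1) thetaSeries =
      expand 2 two_ne_zero (rescale (-1) thetaSeries ^ 2) := by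
  ext n
  rcases Nat.even_or_odd' n with ⟨m, rfl | rfl⟩
  · rw [coeff_expand_mul, coeff_two_mul_theta_mul_rescale _ (Or.inr rfl), ← map_pow, coeff_rescale]
  · rw [coeff_expand_of_not_dvd _ _ _ (by omega)]
    have h : rescale (-1) (thetaSeries * rescale (-1) thetaSeries) =
        thetaSeries * rescale (-1) thetaSeries := by
      rw [map_mul, rescale_neg_one_rescale_neg_one, mul_comm]
    have h' := congrArg (coeff (2 * m + 1)) h
    rw [coeff_rescale, (odd_two_mul_add_one m).neg_one_pow] at h'
    linarith

theorem theta_sq_add_rescale_theta_sq :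
    thetaSeries ^ 2 + rescale (-1) thetaSeries ^ 2 =
      2 * expand 2 two_ne_zero (thetaSeries ^ 2) := by
  ext n
  rw [← map_pow, map_add, coeff_rescale, two_mul, map_add]
  rcases Nat.even_or_odd' n with ⟨m, rfl | rfl⟩
  · rw [coeff_expand_mul]
    have h := coeff_two_mul_theta_mul_rescale 1 (Or.inl rfl) m
    rw [rescale_one, RingHom.id_apply, ← sq] at h
    rw [h, (even_two_mul m).neg_one_pow]
    simp
  · rw [coeff_expand_of_not_dvd _ _ _ (by omega), (odd_two_mul_add_one m).neg_one_pow]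
    ring

/-- The finite product `∏ (1 + z q ^ (2 k + 1)) (z + q ^ (2 k + 1))` as a polynomial in `z`. -/
noncomputable def tripleProd (N : ℕ) : Polynomial ℤ⟦X⟧ :=
  ∏ k ∈ range N, (1 + Polynomial.C (X ^ (2 * k + 1)) * Polynomial.X) *
    (Polynomial.X + Polynomial.C (X ^ (2 * k + 1)))

theorem tripleProd_succ (N : ℕ) : tripleProd (N + 1) = tripleProd N *
    ((1 + Polynomial.C (X ^ (2 * N + 1)) * Polynomial.X) *
    (Polynomial.X + Polynomial.C (X ^ (2 * N + 1)))) := prod_range_succ _ _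

theorem tripleProd_functional_equation (N : ℕ) :
    (tripleProd N).comp (Polynomial.C (X ^ 2) * Polynomial.X) *
      (Polynomial.C X * Polynomial.X + Polynomial.C (X ^ (2 * N))) =
    Polynomial.C (X ^ (2 * N)) * (1 + Polynomial.C (X ^ (2 * N + 1)) * Polynomial.X) *
      tripleProd N := by
  induction N with
  | zero => simp [tripleProd]; ring
  | succ N ih =>
    rw [tripleProd_succ]
    simp only [Polynomial.mul_comp, Polynomial.add_comp, Polynomial.one_comp, Polynomial.C_comp,
      Polynomial.X_comp, Polynomial.pow_comp, map_pow] at ih ⊢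
    linear_combination (Polynomial.C X ^ 2 * (1 + Polynomial.C X ^ (2 * N + 3) * Polynomial.X) *
      (Polynomial.X + Polynomial.C X ^ (2 * N + 1))) * ih

theorem natDegree_tripleProd_le (N : ℕ) : (tripleProd N).natDegree ≤ 2 * N := by
  induction N with
  | zero => simp [tripleProd]
  | succ N ih =>
    rw [tripleProd_succ]
    compute_degree
    omega

theorem coeff_tripleProd_succ (N m : ℕ) :
    X ^ (2 * N) * (1 - X ^ (2 * m + 2)) * (tripleProd N).coeff (m + 1) =
      X ^ (2 * m + 1) * (tripleProd N).coeff m - X ^ (4 * N + 1) * (tripleProd N).coeff m := by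
  have h : Polynomial.C X * (Polynomial.X *
        (tripleProd N).comp (Polynomial.C (X ^ 2) * Polynomial.X)) +
      Polynomial.C (X ^ (2 * N)) * (tripleProd N).comp (Polynomial.C (X ^ 2) * Polynomial.X) =
      Polynomial.C (X ^ (2 * N)) * tripleProd N +
        Polynomial.C (X ^ (4 * N + 1)) * (Polynomial.X * tripleProd N) := by
    have h0 := tripleProd_functional_equation N
    simp only [map_pow] at h0 ⊢
    linear_combination h0
  have h' := congrArg (fun p => Polynomial.coeff p (m + 1)) h
  simp only [Polynomial.coeff_add, Polynomial.coeff_C_mul, Polynomial.coeff_X_mul,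
    Polynomial.comp_C_mul_X_coeff] at h'
  linear_combination -h'

theorem coeff_tripleProd_add (N j : ℕ) (hj : j ≤ N) :
    (X : ℤ⟦X⟧) ^ (2 * N + 1) ∣
      (tripleProd N).coeff (N + j) - X ^ (j ^ 2) * (tripleProd N).coeff N := by
  induction j with
  | zero => simp
  | succ j ih =>
    obtain ⟨r, hr⟩ := ih (by omega)
    have h := coeff_tripleProd_succ N (N + j)
    obtain ⟨i, rfl⟩ := Nat.exists_eq_add_of_le hj
    set M := j + 1 + i with hM
    have h2 : (X : ℤ⟦X⟧) ^ (2 * M) * ((tripleProd M).coeff (M + (j + 1)) -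
        X ^ ((j + 1) ^ 2) * (tripleProd M).coeff M) = X ^ (2 * M) * (X ^ (2 * M + 1) *
        (X ^ (2 * j + 1) * r - (tripleProd M).coeff (M + j)
          + X ^ (2 * j + 1) * (tripleProd M).coeff (M + (j + 1)))) := by
      rw [show M + (j + 1) = M + j + 1 by ring]
      linear_combination h + X ^ (2 * M + 2 * j + 1) * hr
    exact ⟨_, mul_left_cancel₀ (pow_ne_zero _ X_ne_zero) h2⟩

theorem coeff_tripleProd_sub (N j : ℕ) (hj : j ≤ N) :
    (X : ℤ⟦X⟧) ^ (2 * N + 1) ∣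
      (tripleProd N).coeff (N - j) - X ^ (j ^ 2) * (tripleProd N).coeff N := by
  induction j with
  | zero => simp
  | succ j ih =>
    obtain ⟨r, hr⟩ := ih (by omega)
    obtain ⟨i, rfl⟩ := Nat.exists_eq_add_of_le hj
    have h := coeff_tripleProd_succ (j + 1 + i) i
    rw [show j + 1 + i - j = i + 1 by omega] at hr
    rw [show j + 1 + i - (j + 1) = i by omega]
    set M := j + 1 + i with hM
    have h2 : (X : ℤ⟦X⟧) ^ (2 * i + 1) * ((tripleProd M).coeff i -
        X ^ ((j + 1) ^ 2) * (tripleProd M).coeff M) = X ^ (2 * i + 1) * (X ^ (2 * M + 1) *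
        (X ^ (2 * j + 1) * r + X ^ (2 * j + 1) * (tripleProd M).coeff i
          - (tripleProd M).coeff (i + 1))) := by
      rw [hM] at h hr ⊢
      linear_combination - h + X ^ (2 * (j + 1 + i)) * hr
    exact ⟨_, mul_left_cancel₀ (pow_ne_zero _ X_ne_zero) h2⟩

theorem X_pow_dvd_oddProd_sq_sub (N : ℕ) :
    (X : ℤ⟦X⟧) ^ (2 * N + 1) ∣ oddProd N ^ 2 - (tripleProd N).coeff N * thetaSum N := by
  have h1 : oddProd N ^ 2 = (tripleProd N).eval 1 := by
    rw [tripleProd, Polynomial.eval_prod, oddProd, ← prod_pow]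
    simp [sq]
  have h2 : (tripleProd N).eval 1 =
      ∑ j ∈ Icc (-(N : ℤ)) N, (tripleProd N).coeff (N + j).toNat := by
    rw [Polynomial.eval_eq_sum_range' (Nat.lt_succ_of_le (natDegree_tripleProd_le N))]
    refine sum_nbij' (fun m => (m : ℤ) - N) (fun j => (N + j).toNat) ?_ ?_ ?_ ?_ ?_
    · intro m hm; simp only [mem_range, mem_Icc] at hm ⊢; omega
    · intro m hm; simp only [mem_range, mem_Icc] at hm ⊢; omega
    · intro m hm; simp
    · intro m hm; simp only [mem_Icc] at hm; omega
    · intro m hm; simp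
  rw [h1, h2, thetaSum, mul_sum, ← sum_sub_distrib]
  refine dvd_sum fun j hj => ?_
  rw [mem_Icc] at hj
  rw [mul_comm ((tripleProd N).coeff N)]
  rcases le_total 0 j with h | h
  · have := coeff_tripleProd_add N j.natAbs (by omega)
    rwa [show N + j.natAbs = (N + j).toNat by omega] at this
  · have := coeff_tripleProd_sub N j.natAbs (by omega)
    rwa [show N - j.natAbs = (N + j).toNat by omega] at this

theorem rescale_coeff_tripleProd_self (N : ℕ) :
    rescale (-1) ((tripleProd N).coeff N) = (tripleProd N).coeff N := by
  have h : ((tripleProd N).map (rescale (-1 : ℤ))).comp (Polynomial.C (-1) * Polynomial.X) =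
      Polynomial.C ((-1) ^ N) * tripleProd N := by
    induction N with
    | zero => simp [tripleProd]
    | succ N ih =>
      rw [tripleProd_succ, Polynomial.map_mul, Polynomial.mul_comp, ih, pow_succ (-1 : ℤ⟦X⟧) N]
      have : rescale (-1 : ℤ) (X ^ (2 * N + 1)) = - X ^ (2 * N + 1) := by
        rw [map_pow, rescale_X, map_neg, map_one, neg_one_mul,
          (odd_two_mul_add_one N).neg_pow]
      simp only [Polynomial.map_mul, Polynomial.map_add, Polynomial.map_one, Polynomial.map_C,
        Polynomial.map_X, this, Polynomial.mul_comp, Polynomial.add_comp, Polynomial.one_comp,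
        Polynomial.C_comp, Polynomial.X_comp, Polynomial.neg_comp, map_mul, map_neg, map_one]
      ring
  have h' := congrArg (fun p => Polynomial.coeff p N) h
  simp only [Polynomial.comp_C_mul_X_coeff, Polynomial.coeff_map, Polynomial.coeff_C_mul] at h'
  rw [mul_comm] at h'
  exact mul_left_cancel₀ (pow_ne_zero N (by simp)) h'

theorem constantCoeff_coeff_tripleProd_self (N : ℕ) :
    constantCoeff ((tripleProd N).coeff N) = 1 := by
  have h : (tripleProd N).map (constantCoeff (R := ℤ)) = Polynomial.X ^ N := by
    simp [tripleProd, Polynomial.map_prod]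
  rw [← Polynomial.coeff_map, h, Polynomial.coeff_X_pow, if_pos rfl]

theorem X_pow_dvd_of_dvd_mul {k : ℕ} {f g : ℤ⟦X⟧} (hf : constantCoeff f = 1)
    (h : X ^ k ∣ f * g) : X ^ k ∣ g := by
  have hu : IsUnit f := isUnit_iff_constantCoeff.2 (by simp [hf])
  exact (hu.dvd_mul_left).1 h

/-- Truncation of `∏ (1 - q ^ (i + 1))`. -/
noncomputable def eulerProd (N : ℕ) : ℤ⟦X⟧ := ∏ i ∈ range N, (1 - X ^ (i + 1))

theorem distinctProd_mul_rescale_oddProd_mul_eulerProd (N : ℕ) :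
    distinctProd N * rescale (-1) (oddProd N) * eulerProd N = eulerProd (2 * N) := by
  induction N with
  | zero => simp [distinctProd, oddProd, eulerProd]
  | succ N ih =>
    have : rescale (-1 : ℤ) (X ^ (2 * N + 1)) = - X ^ (2 * N + 1) := by
      rw [map_pow, rescale_X, map_neg, map_one, neg_one_mul, (odd_two_mul_add_one N).neg_pow]
    rw [show 2 * (N + 1) = 2 * N + 1 + 1 by ring]
    simp only [distinctProd, oddProd, eulerProd, prod_range_succ, map_mul, map_add, map_one,
      this] at ih ⊢
    rw [← ih]
    ring

theorem X_pow_dvd_eulerProd_sub (N k : ℕ) :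
    (X : ℤ⟦X⟧) ^ (N + 1) ∣ eulerProd (N + k) - eulerProd N := by
  induction k with
  | zero => simp
  | succ k ih =>
    have : eulerProd (N + (k + 1)) = eulerProd (N + k) * (1 - X ^ (N + k + 1)) :=
      prod_range_succ _ _
    obtain ⟨r, hr⟩ := ih
    exact ⟨r - X ^ k * eulerProd (N + k), by rw [this]; linear_combination hr⟩

theorem X_pow_dvd_distinctProd_mul_rescale_oddProd_sub_one (N : ℕ) :
    (X : ℤ⟦X⟧) ^ (N + 1) ∣ distinctProd N * rescale (-1) (oddProd N) - 1 := by
  refine X_pow_dvd_of_dvd_mul (f := eulerProd N) (by simp [eulerProd, map_prod]) ?_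
  have h := X_pow_dvd_eulerProd_sub N N
  rw [← two_mul, ← distinctProd_mul_rescale_oddProd_mul_eulerProd] at h
  convert h using 1
  ring

theorem X_pow_dvd_prod_sq_mul_rescale_theta_sub (N : ℕ) :
    (X : ℤ⟦X⟧) ^ (N + 1) ∣
      (oddProd N * distinctProd N) ^ 2 * rescale (-1) thetaSeries - thetaSeries := by
  refine X_pow_dvd_of_dvd_mul (constantCoeff_coeff_tripleProd_self N) ?_
  obtain ⟨a, ha⟩ := (pow_dvd_pow (X : ℤ⟦X⟧) (by omega : N + 1 ≤ 2 * N + 1)).trans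
    (X_pow_dvd_oddProd_sq_sub N)
  obtain ⟨b, hb⟩ := X_pow_dvd_thetaSeries_sub N
  obtain ⟨d, hd⟩ := X_pow_dvd_distinctProd_mul_rescale_oddProd_sub_one N
  have hc : oddProd N ^ 2 - (tripleProd N).coeff N * thetaSeries =
      X ^ (N + 1) * (a - (tripleProd N).coeff N * b) := by
    linear_combination ha - (tripleProd N).coeff N * hb
  obtain ⟨e, he⟩ := X_pow_dvd_rescale (-1) (Dvd.intro _ hc.symm)
  simp only [map_sub, map_mul, map_pow, rescale_coeff_tripleProd_self] at he
  refine ⟨a - (tripleProd N).coeff N * b - (oddProd N * distinctProd N) ^ 2 * e +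
    oddProd N ^ 2 * (distinctProd N * rescale (-1) (oddProd N) + 1) * d, ?_⟩
  linear_combination hc - (oddProd N * distinctProd N) ^ 2 * he +
    oddProd N ^ 2 * (distinctProd N * rescale (-1) (oddProd N) + 1) * hd

theorem constantCoeff_thetaSeries : constantCoeff thetaSeries = 1 := by
  rw [← coeff_zero_eq_constantCoeff_apply]
  simp [thetaSeries, filter_singleton]

theorem rescale_thetaSeries_ne_zero (ε : ℤ) : rescale ε thetaSeries ≠ 0 := by
  intro h
  have := congrArg (coeff 0) h
  rw [coeff_rescale] at this
  simp [constantCoeff_thetaSeries] at this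

/-- The quotient `θ(q) / θ(-q)` of theta series. -/
noncomputable def thetaQuotient : ℤ⟦X⟧ := thetaSeries * invOfUnit (rescale (-1) thetaSeries) 1

theorem thetaQuotient_mul : thetaQuotient * rescale (-1) thetaSeries = thetaSeries := by
  have h : constantCoeff (rescale (-1) thetaSeries) = ((1 : ℤˣ) : ℤ) := by
    rw [← coeff_zero_eq_constantCoeff_apply, coeff_rescale]
    simp [constantCoeff_thetaSeries]
  rw [thetaQuotient, mul_assoc, mul_comm (invOfUnit _ _), mul_invOfUnit _ _ h, mul_one]

theorem X_pow_dvd_prod_sq_sub_thetaQuotient (N : ℕ) :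
    (X : ℤ⟦X⟧) ^ (N + 1) ∣ (oddProd N * distinctProd N) ^ 2 - thetaQuotient := by
  refine X_pow_dvd_of_dvd_mul (f := rescale (-1) thetaSeries) ?_ ?_
  · rw [← coeff_zero_eq_constantCoeff_apply, coeff_rescale]
    simp [constantCoeff_thetaSeries]
  · have h := X_pow_dvd_prod_sq_mul_rescale_theta_sub N
    convert h using 1
    linear_combination - thetaQuotient_mul

theorem thetaQuotient_add_rescale :
    thetaQuotient + rescale (-1) thetaQuotient =
      2 * expand 2 two_ne_zero (thetaQuotient ^ 2) := by
  have h0 := thetaQuotient_mul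
  have h1 := congrArg (rescale (-1)) h0
  rw [map_mul, rescale_neg_one_rescale_neg_one] at h1
  have h2 := congrArg (expand 2 two_ne_zero) h0
  rw [map_mul] at h2
  have h3 := theta_mul_rescale_theta
  have h4 := theta_sq_add_rescale_theta_sq
  rw [map_pow] at h3 h4 ⊢
  have hne : thetaSeries * rescale (-1) thetaSeries ≠ 0 :=
    mul_ne_zero (by simpa using rescale_thetaSeries_ne_zero 1) (rescale_thetaSeries_ne_zero _)
  refine mul_right_cancel₀ hne ?_
  rw [← h2] at h4
  linear_combination thetaSeries * h0 + rescale (-1) thetaSeries * h1 + h4 -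
    2 * expand 2 two_ne_zero thetaQuotient ^ 2 * h3

theorem coeff_two_mul_thetaQuotient (n : ℕ) :
    coeff (2 * n) thetaQuotient = coeff n (thetaQuotient ^ 2) := by
  have h := congrArg (coeff (2 * n)) thetaQuotient_add_rescale
  rw [map_add, coeff_rescale, (even_two_mul n).neg_one_pow, two_mul (expand _ _ _), map_add,
    coeff_expand_mul] at h
  linarith

theorem coeff_eq_of_X_pow_dvd_sub {k n : ℕ} (h : n < k) {f g : ℤ⟦X⟧} (hd : X ^ k ∣ f - g) :
    coeff n f = coeff n g := by
  have := X_pow_dvd_iff.1 hd n h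
  rwa [map_sub, sub_eq_zero] at this

/-- The number of quadruples `(μ₁, μ₂, ν₁, ν₂)` with `μ₁, μ₂` partitions into distinct odd
parts, `ν₁, ν₂` partitions into distinct parts, of total weight `2n`, equals the number of
octuples `(μ₁, …, μ₄, ν₁, …, ν₄)` with `μ₁, …, μ₄` partitions into distinct odd parts and
`ν₁, …, ν₄` partitions into distinct parts, of total weight `n`. -/
theorem quadruples_two_mul_eq_octuples (n : ℕ) :
    Nat.card {q : (Fin 2 → Multiset ℕ) × (Fin 2 → Multiset ℕ) //
      (∀ k, DistinctOddPartition (q.1 k)) ∧ (∀ k, DistinctPartition (q.2 k)) ∧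
      (∑ k, (q.1 k).sum) + (∑ k, (q.2 k).sum) = 2 * n} =
    Nat.card {q : (Fin 4 → Multiset ℕ) × (Fin 4 → Multiset ℕ) //
      (∀ k, DistinctOddPartition (q.1 k)) ∧ (∀ k, DistinctPartition (q.2 k)) ∧
      (∑ k, (q.1 k).sum) + (∑ k, (q.2 k).sum) = n} := by
  apply Nat.cast_injective (R := ℤ)
  rw [card_tuples_eq_coeff 2 (2 * n) (2 * n + 1) (by omega),
    card_tuples_eq_coeff 4 n (2 * n + 1) (by omega)]
  have h := X_pow_dvd_prod_sq_sub_thetaQuotient (2 * n + 1)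
  rw [coeff_eq_of_X_pow_dvd_sub (by omega) h, coeff_two_mul_thetaQuotient]
  refine (coeff_eq_of_X_pow_dvd_sub (k := 2 * n + 1 + 1) (by omega) ?_).symm
  rw [show 4 = 2 * 2 from rfl, pow_mul]
  exact h.trans (sub_dvd_pow_sub_pow _ _ 2)
end

section
/- Let a(n) denote the number of quadruples (μ₁, μ₂, ν₁, ν₂) where μ₁ and μ₂ are partitions into distinct odd parts, ν₁ and ν₂ are partitions into distinct parts, and |μ₁| + |μ₂| + |ν₁| + |ν₂| = n. Then for every natural number n, a(2n) = Σ_{i=0}^{n} a(i) · a(n − i); that is, the sequence (a(n)) is 2-convolutive. -/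
open Polynomial in
/-- The truncated generating polynomial `∏_{k < n} (1 + X ^ (2k+1))` of partitions into distinct
odd parts. -/
noncomputable def distinctOddPoly (n : ℕ) : ℤ[X] := ∏ k ∈ Finset.range n, (1 + X ^ (2 * k + 1))

open Polynomial in
/-- The truncated generating polynomial `∏_{k < n} (1 + X ^ (k+1))` of partitions into distinct
parts. -/
noncomputable def distinctPoly (n : ℕ) : ℤ[X] := ∏ k ∈ Finset.range n, (1 + X ^ (k + 1))

/-- The finite `q`-Pochhammer symbol `(q; q)_n`. -/
def qPochhammer {R : Type*} [CommRing R] (q : R) (n : ℕ) : R :=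
  ∏ k ∈ Finset.range n, (1 - q ^ (k + 1))

/-- The Gaussian binomial coefficient. -/
def qChoose {R : Type*} [CommRing R] (q : R) : ℕ → ℕ → R
  | _, 0 => 1
  | 0, _ + 1 => 0
  | m + 1, j + 1 => qChoose q m j + q ^ (j + 1) * qChoose q m (j + 1)

open Polynomial in
/-- The truncated theta series `∑_{|z| ≤ n} X ^ (z ^ 2)`. -/
noncomputable def thetaPoly (n : ℕ) : ℤ[X] := ∑ z ∈ Finset.Icc (-n : ℤ) n, X ^ (z.natAbs ^ 2)

section QChoose

variable {R : Type*} [CommRing R] (q : R)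

@[simp] lemma qChoose_zero_right (m : ℕ) : qChoose q m 0 = 1 := by cases m <;> rfl

lemma qChoose_succ_succ (m j : ℕ) :
    qChoose q (m + 1) (j + 1) = qChoose q m j + q ^ (j + 1) * qChoose q m (j + 1) := rfl

lemma qChoose_eq_zero_of_lt {m j : ℕ} (h : m < j) : qChoose q m j = 0 := by
  induction m generalizing j with
  | zero => obtain _ | j := j
            · omega
            · rfl
  | succ m ih =>
    obtain _ | j := j
    · omega
    · rw [qChoose_succ_succ, ih (by omega), ih (by omega)]; simp

lemma qChoose_succ_succ' {m j : ℕ} (h : j ≤ m) :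
    qChoose q (m + 1) (j + 1) = q ^ (m - j) * qChoose q m j + qChoose q m (j + 1) := by
  induction m generalizing j with
  | zero =>
    obtain rfl : j = 0 := by omega
    simp [qChoose]
  | succ m ih =>
    rw [qChoose_succ_succ]
    obtain _ | j := j
    · have h1 := ih (Nat.zero_le m)
      have h2 := qChoose_succ_succ q m 0
      simp only [qChoose_zero_right, Nat.sub_zero] at h1 h2 ⊢
      linear_combination q * h1 - h2
    · rcases (Nat.le_of_succ_le_succ h).eq_or_lt with rfl | hlt
      · simp [qChoose_eq_zero_of_lt q (Nat.lt_succ_self (j + 1))]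
      · obtain ⟨k, rfl⟩ : ∃ k, m = j + 1 + k := ⟨m - (j + 1), by omega⟩
        have h1 := ih (show j ≤ j + 1 + k by omega)
        have h2 := ih (show j + 1 ≤ j + 1 + k by omega)
        have h3 := qChoose_succ_succ q (j + 1 + k) j
        have h4 := qChoose_succ_succ q (j + 1 + k) (j + 1)
        rw [show j + 1 + k - j = k + 1 by omega] at h1
        rw [show j + 1 + k - (j + 1) = k by omega] at h2
        rw [show j + 1 + k + 1 - (j + 1) = k + 1 by omega]
        linear_combination h1 + q ^ (j + 2) * h2 - q ^ (k + 1) * h3 - h4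

lemma qChoose_mul_qPochhammer (i j : ℕ) :
    qChoose q (i + j) i * (qPochhammer q i * qPochhammer q j) = qPochhammer q (i + j) := by
  induction h : i + j generalizing i j with
  | zero =>
    obtain ⟨rfl, rfl⟩ : i = 0 ∧ j = 0 := by omega
    simp [qPochhammer]
  | succ m ih =>
    obtain _ | i := i
    · obtain rfl : j = m + 1 := by omega
      simp [qPochhammer]
    · rw [qChoose_succ_succ]
      have h1 := ih i j (by omega)
      obtain _ | j := j
      · obtain rfl : i = m := by omega
        rw [qChoose_eq_zero_of_lt q (Nat.lt_succ_self i)]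
        simp only [qPochhammer, Finset.prod_range_succ, Finset.prod_range_zero] at h1 ⊢
        linear_combination (1 - q ^ (i + 1)) * h1
      · have h2 := ih (i + 1) j (by omega)
        obtain rfl : m = i + 1 + j := by omega
        simp only [qPochhammer, Finset.prod_range_succ] at h1 h2 ⊢
        linear_combination (1 - q ^ (i + 1)) * h1 + q ^ (i + 1) * (1 - q ^ (j + 1)) * h2

lemma sum_mul_qChoose_succ (c : ℕ → R) (m : ℕ) :
    ∑ j ∈ Finset.range (m + 2), c j * qChoose q (m + 1) j =
      ∑ j ∈ Finset.range (m + 1), (c (j + 1) + q ^ j * c j) * qChoose q m j := by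
  have h := Finset.sum_range_succ' (fun j ↦ q ^ j * c j * qChoose q m j) (m + 1)
  rw [Finset.sum_range_succ, qChoose_eq_zero_of_lt q (Nat.lt_succ_self m)] at h
  rw [Finset.sum_range_succ']
  simp only [qChoose_succ_succ, mul_add, add_mul, Finset.sum_add_distrib]
  simp only [qChoose_zero_right, pow_zero, one_mul, mul_one, mul_zero, add_zero] at h ⊢
  rw [h, ← add_assoc]
  congr 2
  exact Finset.sum_congr rfl fun j _ ↦ by ring

lemma sum_mul_qChoose_succ' (c : ℕ → R) (m : ℕ) :
    ∑ j ∈ Finset.range (m + 2), c j * qChoose q (m + 1) j =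
      ∑ j ∈ Finset.range (m + 1), (q ^ (m - j) * c (j + 1) + c j) * qChoose q m j := by
  have h := Finset.sum_range_succ' (fun j ↦ c j * qChoose q m j) (m + 1)
  rw [Finset.sum_range_succ, qChoose_eq_zero_of_lt q (Nat.lt_succ_self m)] at h
  have h' : ∀ j ∈ Finset.range (m + 1), c (j + 1) * qChoose q (m + 1) (j + 1) =
      q ^ (m - j) * c (j + 1) * qChoose q m j + c (j + 1) * qChoose q m (j + 1) := by
    intro j hj
    rw [qChoose_succ_succ' q (by simpa [Nat.lt_succ_iff] using hj)]
    ring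
  rw [Finset.sum_range_succ', Finset.sum_congr rfl h']
  simp only [add_mul, Finset.sum_add_distrib]
  simp only [qChoose_zero_right, mul_one, mul_zero, add_zero] at h ⊢
  rw [h, add_assoc]

end QChoose

section Products

open Polynomial

/-- A finite form of the Jacobi triple product at `z = 1`. -/
lemma distinctOddPoly_mul_distinctOddPoly (a b : ℕ) :
    distinctOddPoly a * distinctOddPoly b =
      ∑ j ∈ Finset.range (a + b + 1),
        X ^ (((j : ℤ) - b).natAbs ^ 2) * qChoose (X ^ 2 : ℤ[X]) (a + b) j := by
  have key : ∀ (x y : ℤ) (k l : ℕ), x ^ 2 + k = y ^ 2 + l →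
      (X : ℤ[X]) ^ (x.natAbs ^ 2) * X ^ k = X ^ (y.natAbs ^ 2) * X ^ l := by
    intro x y k l h
    rw [← pow_add, ← pow_add]
    congr 1
    zify
    simpa using h
  induction b with
  | zero =>
    induction a with
    | zero => simp [distinctOddPoly]
    | succ a ih =>
      have h : distinctOddPoly (a + 1) = distinctOddPoly a * (1 + X ^ (2 * a + 1)) :=
        Finset.prod_range_succ _ _
      rw [h, mul_right_comm, ih, add_zero, add_zero, sum_mul_qChoose_succ', Finset.sum_mul]
      refine Finset.sum_congr rfl fun j hj ↦ ?_
      have hj' : j ≤ a := by simpa [Nat.lt_succ_iff] using hj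
      have := key (((j + 1 : ℕ) : ℤ) - (0 : ℕ)) ((j : ℤ) - (0 : ℕ)) (2 * (a - j)) (2 * a + 1)
        (by push_cast [hj']; ring)
      rw [← pow_mul]
      linear_combination -qChoose (X ^ 2 : ℤ[X]) a j * this
  | succ b ih =>
    have h : distinctOddPoly (b + 1) = distinctOddPoly b * (1 + X ^ (2 * b + 1)) :=
      Finset.prod_range_succ _ _
    rw [h, ← mul_assoc, ih, ← add_assoc, sum_mul_qChoose_succ, Finset.sum_mul]
    refine Finset.sum_congr rfl fun j _ ↦ ?_
    have h1 := key (((j + 1 : ℕ) : ℤ) - (b + 1 : ℕ)) ((j : ℤ) - b) 0 0 (by push_cast; ring)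
    have h2 := key ((j : ℤ) - (b + 1 : ℕ)) ((j : ℤ) - b) (2 * j) (2 * b + 1) (by push_cast; ring)
    rw [← pow_mul]
    simp only [pow_zero, mul_one] at h1
    linear_combination -qChoose (X ^ 2 : ℤ[X]) (a + b) j * (h1 + h2)

lemma distinctPoly_two_mul (n : ℕ) :
    distinctPoly (2 * n) = distinctOddPoly n * expand ℤ 2 (distinctPoly n) := by
  induction n with
  | zero => simp [distinctPoly, distinctOddPoly]
  | succ n ih =>
    simp only [distinctPoly, distinctOddPoly, mul_add, mul_one, Finset.prod_range_succ] at ih ⊢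
    rw [ih]
    simp only [map_mul, map_add, map_pow, expand_X]
    ring

lemma expand_qPochhammer (n : ℕ) :
    expand ℤ 2 (qPochhammer X n) = qPochhammer (X ^ 2) n := by
  simp [qPochhammer, map_prod]

lemma distinctPoly_mul_qPochhammer (n : ℕ) :
    distinctPoly n * qPochhammer X n = qPochhammer (X ^ 2) n := by
  rw [distinctPoly, qPochhammer, qPochhammer, ← Finset.prod_mul_distrib]
  exact Finset.prod_congr rfl fun k _ ↦ by ring

lemma sum_X_pow_eq_thetaPoly (n : ℕ) :
    ∑ j ∈ Finset.range (n + n + 1), (X : ℤ[X]) ^ (((j : ℤ) - n).natAbs ^ 2) = thetaPoly n := by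
  refine Finset.sum_nbij' (fun j ↦ (j : ℤ) - n) (fun z ↦ (z + n).toNat) ?_ ?_ ?_ ?_ ?_ <;>
    simp only [Finset.mem_range, Finset.mem_Icc, implies_true] <;> intros <;> omega

lemma coeff_thetaPoly_sq (n d : ℕ) :
    (thetaPoly n ^ 2).coeff d =
      (((Finset.Icc (-n : ℤ) n ×ˢ Finset.Icc (-n : ℤ) n).filter
        fun p ↦ p.1.natAbs ^ 2 + p.2.natAbs ^ 2 = d).card : ℤ) := by
  rw [thetaPoly, sq, Finset.sum_mul_sum, ← Finset.sum_product', finsetSum_coeff,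
    Finset.card_filter]
  push_cast
  refine Finset.sum_congr rfl fun p _ ↦ ?_
  rw [← pow_add, coeff_X_pow]
  simp only [eq_comm]

lemma coeff_thetaPoly_sq_two_mul {n d : ℕ} (h : 2 * d ≤ n) :
    (thetaPoly n ^ 2).coeff (2 * d) = (thetaPoly n ^ 2).coeff d := by
  rw [coeff_thetaPoly_sq, coeff_thetaPoly_sq]
  congr 1
  have bound : ∀ {x y : ℤ}, x ^ 2 + y ^ 2 ≤ n → -(n : ℤ) ≤ x ∧ x ≤ n := by
    intro x y hxy
    constructor <;> nlinarith [sq_nonneg y, sq_nonneg x]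
  have bound' : ∀ {x y : ℤ}, x ^ 2 + y ^ 2 ≤ n → -(n : ℤ) ≤ y ∧ y ≤ n := fun h ↦
    bound (by rwa [add_comm])
  symm
  refine Finset.card_nbij' (fun p ↦ (p.1 + p.2, p.1 - p.2))
    (fun p ↦ ((p.1 + p.2) / 2, (p.1 - p.2) / 2)) ?_ ?_ ?_ ?_
  · rintro ⟨x, y⟩ hp
    simp only [Finset.coe_filter, Finset.mem_product, Finset.mem_Icc, Set.mem_ofPred_eq] at hp ⊢
    have h1 := hp.2
    zify at h1 h ⊢
    simp only [sq_abs] at h1 ⊢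
    have h2 : (x + y) ^ 2 + (x - y) ^ 2 = 2 * d := by linear_combination 2 * h1
    exact ⟨⟨bound (h2.trans_le h), bound' (h2.trans_le h)⟩, h2⟩
  · rintro ⟨x, y⟩ hp
    simp only [Finset.coe_filter, Finset.mem_product, Finset.mem_Icc, Set.mem_ofPred_eq] at hp ⊢
    have h1 := hp.2
    zify at h1 h ⊢
    simp only [sq_abs] at h1 ⊢
    have hpar : Even (x + y) := by
      have : Even (x ^ 2 + y ^ 2) := ⟨d, by rw [h1]; ring⟩
      simpa [Int.even_add, Int.even_pow] using this
    obtain ⟨u, hu⟩ := hpar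
    obtain rfl : x = u + u - y := by linarith
    have e1 : (u + u - y + y) / 2 = u := by omega
    have e2 : (u + u - y - y) / 2 = u - y := by omega
    rw [e1, e2]
    have h2 : u ^ 2 + (u - y) ^ 2 = d := by nlinarith
    have h3 : u ^ 2 + (u - y) ^ 2 ≤ n := by omega
    exact ⟨⟨bound h3, bound' h3⟩, h2⟩
  · rintro ⟨x, y⟩ -
    simp only [Prod.mk.injEq]
    omega
  · rintro ⟨x, y⟩ hp
    simp only [Finset.coe_filter, Finset.mem_product, Finset.mem_Icc, Set.mem_ofPred_eq] at hp
    have h1 := hp.2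
    zify at h1
    simp only [sq_abs] at h1
    have hpar : Even (x + y) := by
      have : Even (x ^ 2 + y ^ 2) := ⟨d, by rw [h1]; ring⟩
      simpa [Int.even_add, Int.even_pow] using this
    obtain ⟨u, hu⟩ := hpar
    simp only [Prod.mk.injEq]
    omega

end Products

section Truncation

open Polynomial

/-- Reduction of integer polynomials modulo `X ^ M`. -/
noncomputable abbrev truncHom (M : ℕ) : ℤ[X] →+* ℤ[X] ⧸ Ideal.span {(X : ℤ[X]) ^ M} :=
  Ideal.Quotient.mk _

lemma truncHom_eq_iff {M : ℕ} {f g : ℤ[X]} :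
    truncHom M f = truncHom M g ↔ ∀ d < M, f.coeff d = g.coeff d := by
  rw [Ideal.Quotient.eq, Ideal.mem_span_singleton, X_pow_dvd_iff]
  simp [sub_eq_zero]

lemma truncHom_X_pow_of_le {M k : ℕ} (h : M ≤ k) : truncHom M (X ^ k) = 0 := by
  rw [Ideal.Quotient.eq_zero_iff_mem, Ideal.mem_span_singleton]
  exact pow_dvd_pow X h

lemma truncHom_prod_range {M n : ℕ} (h : M ≤ n) {f : ℕ → ℤ[X]}
    (hf : ∀ k, M ≤ k → truncHom M (f k) = 1) :
    truncHom M (∏ k ∈ Finset.range n, f k) = truncHom M (∏ k ∈ Finset.range M, f k) := by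
  rw [map_prod, map_prod]
  refine (Finset.prod_subset (Finset.range_mono h) fun k _ hk ↦ hf k ?_).symm
  simpa using hk

lemma truncHom_distinctPoly {M n : ℕ} (h : M ≤ n) :
    truncHom M (distinctPoly n) = truncHom M (distinctPoly M) :=
  truncHom_prod_range h fun k hk ↦ by
    rw [map_add, map_one, truncHom_X_pow_of_le (by omega), add_zero]

lemma truncHom_qPochhammer_X_sq {M n : ℕ} (h : M ≤ n) :
    truncHom M (qPochhammer (X ^ 2) n) = truncHom M (qPochhammer (X ^ 2) M) :=
  truncHom_prod_range h fun k hk ↦ by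
    rw [map_sub, map_one, ← pow_mul, truncHom_X_pow_of_le (by omega), sub_zero]

lemma isUnit_truncHom_qPochhammer (M n : ℕ) {e : ℕ} (he : 0 < e) :
    IsUnit (truncHom M (qPochhammer (X ^ e) n)) := by
  rw [qPochhammer, map_prod, IsUnit.prod_iff]
  intro k _
  rw [map_sub, map_one]
  refine IsNilpotent.isUnit_one_sub ⟨M, ?_⟩
  rw [← map_pow, ← pow_mul, ← pow_mul, ← mul_assoc]
  exact truncHom_X_pow_of_le (Nat.le_mul_of_pos_left M (by positivity))

/-- Truncation of `(-q; q²)² (q²; q²) = ∑ q ^ (z ^ 2)`. -/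
lemma truncHom_distinctOddPoly_sq_mul {M n : ℕ} (h : 2 * M ≤ n) :
    truncHom M (distinctOddPoly n ^ 2 * qPochhammer (X ^ 2) n) = truncHom M (thetaPoly n) := by
  rw [sq, distinctOddPoly_mul_distinctOddPoly, ← sum_X_pow_eq_thetaPoly, Finset.sum_mul,
    map_sum, map_sum]
  refine Finset.sum_congr rfl fun j hj ↦ ?_
  rw [mul_assoc, map_mul]
  by_cases hM : M ≤ ((j : ℤ) - n).natAbs
  · rw [truncHom_X_pow_of_le (hM.trans (Nat.le_self_pow two_ne_zero _)), zero_mul]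
  · obtain ⟨i, hi⟩ : ∃ i, n + n = j + i := ⟨n + n - j, by rw [Finset.mem_range] at hj; omega⟩
    have hq := congrArg (truncHom M) (qChoose_mul_qPochhammer (X ^ 2 : ℤ[X]) j i)
    rw [map_mul, map_mul, truncHom_qPochhammer_X_sq (show M ≤ j by omega),
      truncHom_qPochhammer_X_sq (show M ≤ i by omega),
      truncHom_qPochhammer_X_sq (show M ≤ j + i by omega), ← mul_assoc] at hq
    rw [map_mul, truncHom_qPochhammer_X_sq (show M ≤ n by omega), hi,
      (isUnit_truncHom_qPochhammer M M two_pos).mul_eq_right.mp hq, mul_one]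

lemma truncHom_contract_two {M : ℕ} {f g : ℤ[X]}
    (h : truncHom (2 * M) f = truncHom (2 * M) g) :
    truncHom M (contract 2 f) = truncHom M (contract 2 g) := by
  rw [truncHom_eq_iff] at h ⊢
  intro d hd
  rw [coeff_contract two_ne_zero, coeff_contract two_ne_zero]
  exact h _ (by omega)

lemma truncHom_contract_two_thetaPoly_sq {M n : ℕ} (h : 2 * M ≤ n) :
    truncHom M (contract 2 (thetaPoly n ^ 2)) = truncHom M (thetaPoly n ^ 2) := by
  rw [truncHom_eq_iff]
  intro d hd
  rw [coeff_contract two_ne_zero, mul_comm, coeff_thetaPoly_sq_two_mul (by omega)]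

lemma truncHom_of_le {M N : ℕ} (h : M ≤ N) {f g : ℤ[X]} (hfg : truncHom N f = truncHom N g) :
    truncHom M f = truncHom M g := by
  rw [truncHom_eq_iff] at hfg ⊢
  exact fun d hd ↦ hfg d (by omega)

lemma truncHom_contract_two_quadruple {M n : ℕ} (h : 4 * M ≤ n) :
    truncHom M (contract 2 (distinctOddPoly n ^ 2 * distinctPoly (2 * n) ^ 2)) =
      truncHom M ((distinctOddPoly n ^ 2 * distinctPoly (2 * n) ^ 2) ^ 2) := by
  have hJ := truncHom_distinctOddPoly_sq_mul (M := 2 * M) (n := n) (by omega)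
  have hJ' := truncHom_of_le (show M ≤ 2 * M by omega) hJ
  have hθ := truncHom_contract_two_thetaPoly_sq (M := M) (n := n) (by omega)
  have hD : truncHom M (distinctPoly (2 * n)) = truncHom M (distinctPoly n) :=
    (truncHom_distinctPoly (by omega)).trans (truncHom_distinctPoly (by omega)).symm
  have hDE := distinctPoly_mul_qPochhammer n
  have h1 : truncHom (2 * M) (distinctOddPoly n ^ 2 * distinctPoly (2 * n) ^ 2 *
        expand ℤ 2 (qPochhammer X n ^ 2)) =
      truncHom (2 * M) (thetaPoly n ^ 2 * expand ℤ 2 (distinctPoly n ^ 2)) := by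
    rw [map_mul _ (thetaPoly n ^ 2), map_pow _ (thetaPoly n), ← hJ, ← map_pow, ← map_mul,
      distinctPoly_two_mul, map_pow, map_pow, expand_qPochhammer]
    congr 1
    ring
  have h2 := truncHom_contract_two h1
  rw [contract_mul_expand two_ne_zero, contract_mul_expand two_ne_zero, map_mul, map_mul, hθ,
    map_pow _ (thetaPoly n), ← hJ', ← hDE] at h2
  have hU := (isUnit_truncHom_qPochhammer M n one_pos).pow 2
  rw [pow_one] at hU
  refine hU.mul_right_cancel ?_
  rw [← map_pow, h2]
  simp only [map_mul, map_pow, hD]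
  ring

end Truncation

section Counting

open Polynomial

lemma prod_one_add_X_pow (s : Finset ℕ) :
    ∏ i ∈ s, (1 + X ^ i : ℤ[X]) = ∑ t ∈ s.powerset, X ^ (∑ i ∈ t, i) := by
  rw [Finset.prod_one_add]
  exact Finset.sum_congr rfl fun t _ ↦ Finset.prod_pow_eq_pow_sum t _ X

lemma distinctOddPoly_eq_sum (n : ℕ) :
    distinctOddPoly n =
      ∑ t ∈ ((Finset.range (2 * n)).filter Odd).powerset, X ^ (∑ i ∈ t, i) := by
  rw [← prod_one_add_X_pow, distinctOddPoly]
  refine Finset.prod_nbij' (fun k ↦ 2 * k + 1) (fun i ↦ i / 2) ?_ ?_ ?_ ?_ ?_ <;>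
    simp only [Finset.mem_range, Finset.mem_filter, Nat.odd_iff, implies_true] <;> intros <;> omega

lemma distinctPoly_eq_sum (n : ℕ) :
    distinctPoly n = ∑ t ∈ (Finset.Icc 1 n).powerset, X ^ (∑ i ∈ t, i) := by
  rw [← prod_one_add_X_pow, distinctPoly]
  refine Finset.prod_nbij' (fun k ↦ k + 1) (fun i ↦ i - 1) ?_ ?_ ?_ ?_ ?_ <;>
    simp only [Finset.mem_range, Finset.mem_Icc, implies_true] <;> intros <;> omega

lemma coeff_quadruple {n m : ℕ} (h : m < 2 * n) :
    (distinctOddPoly n ^ 2 * distinctPoly (2 * n) ^ 2).coeff m =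
      (Nat.card {q : (Fin 2 → Multiset ℕ) × (Fin 2 → Multiset ℕ) //
        (∀ k, DistinctOddPartition (q.1 k)) ∧ (∀ k, DistinctPartition (q.2 k)) ∧
        (∑ k, (q.1 k).sum) + (∑ k, (q.2 k).sum) = m} : ℤ) := by
  set A := ((Finset.range (2 * n)).filter Odd).powerset with hA
  set B := (Finset.Icc 1 (2 * n)).powerset with hB
  have hcoeff : (distinctOddPoly n ^ 2 * distinctPoly (2 * n) ^ 2).coeff m =
      ((((A ×ˢ A) ×ˢ (B ×ˢ B)).filter fun p ↦
        (∑ i ∈ p.1.1, i + ∑ i ∈ p.1.2, i) + (∑ i ∈ p.2.1, i + ∑ i ∈ p.2.2, i) = m).card : ℤ) := by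
    rw [distinctOddPoly_eq_sum, distinctPoly_eq_sum, ← hA, ← hB, sq, sq, Finset.sum_mul_sum,
      Finset.sum_mul_sum, ← Finset.sum_product', ← Finset.sum_product', Finset.sum_mul_sum,
      ← Finset.sum_product', finsetSum_coeff, Finset.card_filter]
    push_cast
    refine Finset.sum_congr rfl fun p _ ↦ ?_
    rw [← pow_add, ← pow_add, ← pow_add, coeff_X_pow]
    simp only [eq_comm]
  rw [hcoeff, ← Nat.card_eq_finsetCard, Nat.cast_inj]
  have odd_mem : ∀ {mu : Multiset ℕ} (h_mu : DistinctOddPartition mu), mu.sum < 2 * n →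
      (⟨mu, h_mu.2⟩ : Finset ℕ) ∈ A := by
    intro mu h_mu hlt
    rw [hA, Finset.mem_powerset]
    intro i hi
    rw [Finset.mem_filter, Finset.mem_range]
    exact ⟨(Multiset.single_le_sum (fun _ _ ↦ Nat.zero_le _) i hi).trans_lt hlt, h_mu.1 i hi⟩
  have pos_mem : ∀ {nu : Multiset ℕ} (h_nu : DistinctPartition nu), nu.sum < 2 * n →
      (⟨nu, h_nu.2⟩ : Finset ℕ) ∈ B := by
    intro nu h_nu hlt
    rw [hB, Finset.mem_powerset]
    intro i hi
    rw [Finset.mem_Icc]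
    exact ⟨h_nu.1 i hi, ((Multiset.single_le_sum (fun _ _ ↦ Nat.zero_le _) i hi).trans_lt hlt).le⟩
  have odd_of_mem : ∀ {s : Finset ℕ}, s ∈ A → DistinctOddPartition s.val := fun hs ↦
    ⟨fun i hi ↦ (Finset.mem_filter.mp (Finset.mem_powerset.mp hs hi)).2, Finset.nodup _⟩
  have pos_of_mem : ∀ {s : Finset ℕ}, s ∈ B → DistinctPartition s.val := fun hs ↦
    ⟨fun i hi ↦ (Finset.mem_Icc.mp (Finset.mem_powerset.mp hs hi)).1, Finset.nodup _⟩
  refine Nat.card_eq_of_bijective (fun p ↦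
    ⟨(![p.1.1.1.val, p.1.1.2.val], ![p.1.2.1.val, p.1.2.2.val]), ?_⟩) ⟨?_, ?_⟩
  · have hp := p.2
    simp only [Finset.mem_filter, Finset.mem_product] at hp
    obtain ⟨⟨⟨h1, h2⟩, h3, h4⟩, h5⟩ := hp
    simp only [Fin.forall_fin_two, Fin.sum_univ_two]
    refine ⟨⟨odd_of_mem h1, odd_of_mem h2⟩, ⟨pos_of_mem h3, pos_of_mem h4⟩, ?_⟩
    simp only [Finset.sum, Multiset.map_id'] at h5
    exact h5
  · rintro ⟨⟨⟨s, t⟩, u, v⟩, _⟩ ⟨⟨⟨s', t'⟩, u', v'⟩, _⟩ h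
    have h1 := congrArg (fun q ↦ q.1.1) h
    have h2 := congrArg (fun q ↦ q.1.2) h
    obtain rfl : s = s' := Finset.val_injective (congrFun h1 0)
    obtain rfl : t = t' := Finset.val_injective (congrFun h1 1)
    obtain rfl : u = u' := Finset.val_injective (congrFun h2 0)
    obtain rfl : v = v' := Finset.val_injective (congrFun h2 1)
    rfl
  · rintro ⟨⟨f, g⟩, hf, hg, hsum⟩
    simp only [Fin.sum_univ_two] at hf hg hsum
    refine ⟨⟨((⟨f 0, (hf 0).2⟩, ⟨f 1, (hf 1).2⟩), (⟨g 0, (hg 0).2⟩, ⟨g 1, (hg 1).2⟩)), ?_⟩, ?_⟩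
    · simp only [Finset.mem_filter, Finset.mem_product]
      refine ⟨⟨⟨odd_mem (hf 0) (by omega), odd_mem (hf 1) (by omega)⟩,
        pos_mem (hg 0) (by omega), pos_mem (hg 1) (by omega)⟩, ?_⟩
      simpa [Finset.sum] using hsum
    · simp only [Subtype.mk.injEq, Prod.mk.injEq]
      constructor <;> funext k <;> fin_cases k <;> rfl

end Counting

/-- If `a n` is the number of quadruples `(μ₁, μ₂, ν₁, ν₂)` with `μ₁, μ₂` partitions into
distinct odd parts, `ν₁, ν₂` partitions into distinct parts, and total weight `n`
(OEIS A007096), then `a` is `2`-convolutive: `a (2n) = ∑_{i=0}^{n} a i * a (n - i)`. -/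
theorem A007096_two_convolutive (a : ℕ → ℕ)
    (ha : ∀ n, a n = Nat.card {q : (Fin 2 → Multiset ℕ) × (Fin 2 → Multiset ℕ) //
      (∀ k, DistinctOddPartition (q.1 k)) ∧ (∀ k, DistinctPartition (q.2 k)) ∧
      (∑ k, (q.1 k).sum) + (∑ k, (q.2 k).sum) = n}) :
    ∀ n, a (2 * n) = ∑ i ∈ Finset.range (n + 1), a i * a (n - i) := by
  intro n
  have hcoeff : ∀ m < 2 * (4 * (n + 1)),
      (distinctOddPoly (4 * (n + 1)) ^ 2 * distinctPoly (2 * (4 * (n + 1))) ^ 2).coeff m = a m :=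
    fun m hm ↦ by rw [coeff_quadruple hm, ha m]
  have key := truncHom_eq_iff.mp
    (truncHom_contract_two_quadruple (le_refl (4 * (n + 1)))) n (Nat.lt_succ_self n)
  rw [Polynomial.coeff_contract two_ne_zero, hcoeff _ (by omega), mul_comm n 2,
    sq (_ * _), Polynomial.coeff_mul,
    Finset.Nat.sum_antidiagonal_eq_sum_range_succ_mk] at key
  zify
  rw [key]
  refine Finset.sum_congr rfl fun i hi ↦ ?_
  rw [Finset.mem_range] at hi
  rw [hcoeff _ (by omega), hcoeff _ (by omega)]
end

section
/- Define PDO(n) = Σ_λ Π_k m_k(λ), where the sum is over all partitions λ of n into odd parts, the product is over the distinct part sizes k occurring in λ, and m_k(λ) is the multiplicity of k in λ (so PDO(n) counts partitions of n with designated summands in which all parts are odd). Then for every natural number n, PDO(2n) = Σ_{i=0}^{n} PDO(i) · PDO(n − i); that is, the sequence (PDO(n)) is 2-convolutive. -/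
namespace DesignatedSummands

open PowerSeries Finset Filter
open scoped PowerSeries.WithPiTopology Topology

section QBinomial

variable {R : Type*} [CommRing R]

/-- The Gaussian binomial coefficient `[n, k]` with base `q`, defined by the `q`-Pascal rule. -/
def qBinom (q : R) : ℕ → ℕ → R
  | _, 0 => 1
  | 0, _ + 1 => 0
  | n + 1, k + 1 => qBinom q n k + q ^ (k + 1) * qBinom q n (k + 1)

/-- The `q`-Pochhammer symbol `(q; q)_n`. -/
def qPoch (q : R) (n : ℕ) : R := ∏ i ∈ range n, (1 - q ^ (i + 1))

lemma qBinom_zero_right (q : R) (n : ℕ) : qBinom q n 0 = 1 := by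
  cases n <;> rfl

lemma qBinom_succ_succ (q : R) (n k : ℕ) :
    qBinom q (n + 1) (k + 1) = qBinom q n k + q ^ (k + 1) * qBinom q n (k + 1) := rfl

lemma qBinom_eq_zero_of_lt (q : R) {n k : ℕ} (h : n < k) : qBinom q n k = 0 := by
  induction n generalizing k with
  | zero => obtain ⟨k, rfl⟩ := Nat.exists_eq_add_one_of_ne_zero h.ne'; rfl
  | succ n ih =>
    obtain ⟨k, rfl⟩ := Nat.exists_eq_add_one_of_ne_zero (by omega : k ≠ 0)
    rw [qBinom_succ_succ, ih (by omega), ih (by omega)]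
    simp

lemma qBinom_self (q : R) (n : ℕ) : qBinom q n n = 1 := by
  induction n with
  | zero => rfl
  | succ n ih => rw [qBinom_succ_succ, ih, qBinom_eq_zero_of_lt q (by omega)]; simp

lemma qPoch_succ (q : R) (n : ℕ) : qPoch q (n + 1) = qPoch q n * (1 - q ^ (n + 1)) :=
  prod_range_succ _ _

lemma qBinom_mul_qPoch (q : R) (a b : ℕ) :
    qBinom q (a + b) a * qPoch q a * qPoch q b = qPoch q (a + b) := by
  induction hn : a + b generalizing a b with
  | zero =>
    obtain ⟨rfl, rfl⟩ : a = 0 ∧ b = 0 := by omega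
    simp [qPoch, qBinom_zero_right]
  | succ n ih =>
    rcases a with _ | a
    · obtain rfl : b = n + 1 := by omega
      simp [qPoch, qBinom_zero_right]
    rcases b with _ | b
    · obtain rfl : a = n := by omega
      rw [qBinom_self]; simp [qPoch]
    have h1 := ih a (b + 1) (by omega)
    have h2 := ih (a + 1) b (by omega)
    obtain rfl : n = a + b + 1 := by omega
    rw [qBinom_succ_succ]
    rw [qPoch_succ] at h1 h2 ⊢
    rw [qPoch_succ q b, qPoch_succ q (a + b + 1)]
    rw [qPoch_succ q (a + b)] at *
    linear_combination (1 - q ^ (a + 1)) * h1 + q ^ (a + 1) * (1 - q ^ (b + 1)) * h2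

/-- The `q`-binomial theorem in homogeneous form. -/
lemma prod_add_mul_pow_eq_sum (q x y : R) (n : ℕ) :
    ∏ k ∈ range n, (y + x * q ^ k) =
      ∑ j ∈ range (n + 1), q ^ (j.choose 2) * qBinom q n j * x ^ j * y ^ (n - j) := by
  induction n generalizing x with
  | zero => simp [qBinom_zero_right]
  | succ n ih =>
    have h : ∏ k ∈ range n, (y + x * q ^ (k + 1)) = ∏ k ∈ range n, (y + x * q * q ^ k) :=
      prod_congr rfl fun k _ ↦ by ring
    rw [prod_range_succ', h, ih, sum_range_succ' _ (n + 1)]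
    have hstep : ∀ j ∈ range (n + 1),
        q ^ ((j + 1).choose 2) * qBinom q (n + 1) (j + 1) * x ^ (j + 1) * y ^ (n + 1 - (j + 1)) =
          q ^ (j.choose 2) * qBinom q n j * (x * q) ^ j * y ^ (n - j) * x +
          q ^ ((j + 1).choose 2) * qBinom q n (j + 1) * (x * q) ^ (j + 1) * y ^ (n - j) := by
      intro j _
      have hc : (j + 1).choose 2 = j + j.choose 2 := by
        rw [Nat.choose_succ_succ' j 1, Nat.choose_one_right]
      rw [qBinom_succ_succ, hc, Nat.succ_sub_succ]
      ring
    rw [sum_congr rfl hstep, sum_add_distrib, ← sum_mul,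
      sum_range_succ (fun j ↦ q ^ ((j + 1).choose 2) * qBinom q n (j + 1) * (x * q) ^ (j + 1) *
        y ^ (n - j)), qBinom_eq_zero_of_lt q (Nat.lt_succ_self n)]
    have hsum : (∑ j ∈ range (n + 1),
          q ^ (j.choose 2) * qBinom q n j * (x * q) ^ j * y ^ (n - j)) * y =
        ∑ j ∈ range n, q ^ ((j + 1).choose 2) * qBinom q n (j + 1) * (x * q) ^ (j + 1) *
          y ^ (n - j) + y ^ (n + 1) := by
      rw [sum_range_succ', add_mul, sum_mul]
      congr 1
      · refine sum_congr rfl fun j hj ↦ ?_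
        rw [mem_range] at hj
        rw [mul_assoc, ← pow_succ]
        congr 2
        omega
      · simp [qBinom_zero_right, pow_succ]
    simp only [qBinom_zero_right]
    simp
    linear_combination hsum

lemma pow_dvd_qPoch_sub (q : R) {k m : ℕ} (h : k ≤ m) :
    q ^ (k + 1) ∣ qPoch q m - qPoch q k := by
  induction m, h using Nat.le_induction with
  | base => simp
  | succ m hm ih =>
    have e : qPoch q (m + 1) - qPoch q k =
        (qPoch q m - qPoch q k) - q ^ (m + 1) * qPoch q m := by
      rw [qPoch_succ]; ring
    rw [e]
    exact dvd_sub ih (Dvd.dvd.mul_right (pow_dvd_pow q (by omega)) _)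

lemma pow_dvd_qPoch_mul_qBinom_sub_one (q : R) (hq : ∀ n, IsUnit (qPoch q n)) {a b c k : ℕ}
    (ha : k ≤ a) (hb : k ≤ b) (hc : k ≤ c) :
    q ^ (k + 1) ∣ qPoch q c * qBinom q (a + b) a - 1 := by
  obtain ⟨ra, hra⟩ := pow_dvd_qPoch_sub q ha
  obtain ⟨rb, hrb⟩ := pow_dvd_qPoch_sub q hb
  obtain ⟨rc, hrc⟩ := pow_dvd_qPoch_sub q hc
  obtain ⟨rs, hrs⟩ := pow_dvd_qPoch_sub q (show k ≤ a + b by omega)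
  rw [← IsUnit.dvd_mul_right ((hq a).mul (hq b))]
  have h := qBinom_mul_qPoch q a b
  refine ⟨rc * qPoch q (a + b) + qPoch q k * rs - ra * qPoch q b - qPoch q k * rb, ?_⟩
  linear_combination qPoch q c * h + qPoch q (a + b) * hrc + qPoch q k * hrs
    - qPoch q b * hra - qPoch q k * hrb

end QBinomial

lemma tendsto_of_X_pow_dvd_sub {R : Type*} [CommRing R] [TopologicalSpace R] {f : ℕ → R⟦X⟧}
    {a : R⟦X⟧} (h : ∀ n, X ^ n ∣ f n - a) : Tendsto f atTop (𝓝 a) := by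
  rw [WithPiTopology.tendsto_iff_coeff_tendsto]
  refine fun d ↦ tendsto_atTop_of_eventually_const (i₀ := d + 1) fun n hn ↦ ?_
  have := X_pow_dvd_iff.mp (h n) d (by omega)
  rwa [map_sub, sub_eq_zero] at this

section Theta

variable {K : Type*} [Field K]

/-- The theta series `∑_{n ∈ ℤ} z ^ n X ^ (n ^ 2)`. -/
noncomputable def theta (z : K) : K⟦X⟧ :=
  PowerSeries.mk fun m ↦ ∑ n ∈ Icc (-(m : ℤ)) m, if n ^ 2 = m then z ^ n else 0

lemma coeff_theta (z : K) {m B : ℕ} (h : m ≤ B) :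
    coeff m (theta z) = ∑ n ∈ Icc (-(B : ℤ)) B, if n ^ 2 = m then z ^ n else 0 := by
  rw [theta, coeff_mk]
  refine sum_subset (Icc_subset_Icc (by omega) (by omega)) fun n _ hn ↦ if_neg fun e ↦ hn ?_
  rw [mem_Icc]
  constructor <;> nlinarith [sq_nonneg (n - 1), sq_nonneg (n + 1), Int.le_self_sq n,
    Int.le_self_sq (-n)]

lemma coeff_theta_mul_theta (z w : K) {k B : ℕ} (h : k ≤ B) :
    coeff k (theta z * theta w) =
      ∑ p ∈ (Icc (-(B : ℤ)) B ×ˢ Icc (-(B : ℤ)) B).filter (fun p : ℤ × ℤ ↦ p.1 ^ 2 + p.2 ^ 2 = k),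
        z ^ p.1 * w ^ p.2 := by
  have h1 : coeff k (theta z * theta w) = ∑ ij ∈ HasAntidiagonal.antidiagonal k,
      ∑ p ∈ Icc (-(B : ℤ)) B ×ˢ Icc (-(B : ℤ)) B,
        if p.1 ^ 2 = ij.1 ∧ p.2 ^ 2 = ij.2 then z ^ p.1 * w ^ p.2 else 0 := by
    rw [coeff_mul]
    refine sum_congr rfl fun ij hij ↦ ?_
    rw [HasAntidiagonal.mem_antidiagonal] at hij
    rw [coeff_theta z (show ij.1 ≤ B by omega), coeff_theta w (show ij.2 ≤ B by omega),
      sum_mul_sum, ← sum_product']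
    refine sum_congr rfl fun p _ ↦ ?_
    split_ifs <;> simp_all
  rw [h1, sum_comm, sum_filter]
  refine sum_congr rfl fun p _ ↦ ?_
  split_ifs with hp
  · rw [sum_eq_single ((p.1 ^ 2).toNat, (p.2 ^ 2).toNat)]
    · rw [if_pos]
      simp [Int.toNat_of_nonneg (sq_nonneg _)]
    · rintro ⟨i, j⟩ _ hne
      refine if_neg fun ⟨e1, e2⟩ ↦ hne ?_
      simp only at e1 e2
      simp [e1, e2]
    · intro hn
      exfalso
      apply hn
      rw [HasAntidiagonal.mem_antidiagonal]
      zify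
      rw [Int.toNat_of_nonneg (sq_nonneg _), Int.toNat_of_nonneg (sq_nonneg _), hp]
  · refine sum_eq_zero fun ij hij ↦ if_neg fun ⟨e1, e2⟩ ↦ hp ?_
    rw [HasAntidiagonal.mem_antidiagonal] at hij
    rw [e1, e2]
    exact_mod_cast hij

lemma coeff_two_mul_theta_mul_theta {z w : K} (hz : z ≠ 0) (hw : w ≠ 0) (m : ℕ) :
    coeff (2 * m) (theta z * theta w) = coeff m (theta (z * w) * theta (z / w)) := by
  rw [coeff_theta_mul_theta z w (B := 2 * m) le_rfl,
    coeff_theta_mul_theta (z * w) (z / w) (B := 2 * m) (by omega)]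
  have bound : ∀ x y : ℤ, x ^ 2 + y ^ 2 ≤ 2 * m → -(2 * m : ℤ) ≤ x ∧ x ≤ 2 * m := by
    intro x y h
    constructor <;> nlinarith [sq_nonneg y, Int.le_self_sq x, Int.le_self_sq (-x)]
  have parity : ∀ x y : ℤ, x ^ 2 + y ^ 2 = 2 * m → ∃ c d, x = c + d ∧ y = c - d := by
    intro x y h
    have he : Even (x + y) := by
      have : Even (x ^ 2 + y ^ 2) := ⟨m, by linarith⟩
      simpa [Int.even_add, Int.even_pow] using this
    obtain ⟨c, hc⟩ := he
    exact ⟨c, x - c, by ring, by linarith⟩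
  refine sum_nbij' (fun p ↦ ((p.1 + p.2) / 2, (p.1 - p.2) / 2)) (fun p ↦ (p.1 + p.2, p.1 - p.2))
    ?_ ?_ ?_ ?_ ?_
  · rintro ⟨x, y⟩ hp
    simp only [mem_filter, mem_product, mem_Icc] at hp ⊢
    push_cast at hp ⊢
    obtain ⟨c, d, rfl, rfl⟩ := parity x y hp.2
    have e1 : (c + d + (c - d)) / 2 = c := by omega
    have e2 : (c + d - (c - d)) / 2 = d := by omega
    rw [e1, e2]
    have h : c ^ 2 + d ^ 2 = m := by linarith [hp.2]
    exact ⟨⟨bound c d (by omega), bound d c (by omega)⟩, h⟩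
  · rintro ⟨c, d⟩ hp
    simp only [mem_filter, mem_product, mem_Icc] at hp ⊢
    push_cast at hp ⊢
    have h : (c + d) ^ 2 + (c - d) ^ 2 = 2 * m := by linarith [hp.2]
    exact ⟨⟨bound _ _ h.le, bound (c - d) (c + d) (by linarith)⟩, h⟩
  · rintro ⟨x, y⟩ hp
    simp only [mem_filter, mem_product, mem_Icc] at hp
    push_cast at hp
    obtain ⟨c, d, rfl, rfl⟩ := parity x y hp.2
    ext <;> simp only <;> omega
  · rintro ⟨c, d⟩ _
    ext <;> simp only <;> omega
  · rintro ⟨x, y⟩ hp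
    simp only [mem_filter, mem_product, mem_Icc] at hp
    push_cast at hp
    obtain ⟨c, d, rfl, rfl⟩ := parity x y hp.2
    have e1 : (c + d + (c - d)) / 2 = c := by omega
    have e2 : (c + d - (c - d)) / 2 = d := by omega
    simp only [e1, e2]
    rw [mul_zpow, div_zpow, zpow_add₀ hz, zpow_sub₀ hw]
    field_simp

lemma coeff_odd_theta_one_mul_theta_neg_one [CharZero K] {k : ℕ} (hk : Odd k) :
    coeff k (theta (1 : K) * theta (-1)) = 0 := by
  rw [← self_eq_neg]
  conv_rhs => rw [mul_comm]
  rw [coeff_theta_mul_theta _ _ le_rfl, coeff_theta_mul_theta _ _ le_rfl, ← sum_neg_distrib]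
  refine sum_congr rfl fun p hp ↦ ?_
  rw [mem_filter] at hp
  have ho : Odd (p.1 + p.2) := by
    have : Odd (p.1 ^ 2 + p.2 ^ 2) := by rw [hp.2]; exact_mod_cast hk
    simpa [Int.odd_add, Int.odd_pow, Int.even_pow] using this
  have h : (-1 : K) ^ p.1 * (-1) ^ p.2 = -1 := by
    rw [← zpow_add₀ (by simp), ho.neg_one_zpow]
  rcases Int.even_or_odd p.1 with h1 | h1 <;> rcases Int.even_or_odd p.2 with h2 | h2 <;>
    simp [h1.neg_one_zpow, h2.neg_one_zpow] at h ⊢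
  all_goals norm_num at h

end Theta

section TripleProduct

variable {K : Type*} [Field K]

lemma isUnit_qPoch_X_sq (n : ℕ) : IsUnit (qPoch (X ^ 2 : K⟦X⟧) n) := by
  rw [PowerSeries.isUnit_iff_constantCoeff, qPoch, map_prod]
  simp

/-- A finite form of the Jacobi triple product. -/
lemma prod_eq_sum_qBinom (z : K) (N : ℕ) :
    ∏ m ∈ range N, ((C z + X ^ (2 * m + 1)) * (1 + C z * X ^ (2 * m + 1))) =
      ∑ j ∈ range (2 * N + 1),
        X ^ (((j : ℤ) - N) ^ 2).toNat * qBinom (X ^ 2 : K⟦X⟧) (2 * N) j * C z ^ j := by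
  rcases N with _ | N
  · simp [qBinom_zero_right]
  have hX : (X : K⟦X⟧) ^ (3 * (N + 1) * N + (N + 1)) ≠ 0 := pow_ne_zero _ X_ne_zero
  refine mul_left_cancel₀ hX ?_
  have key := prod_add_mul_pow_eq_sum (X ^ 2 : K⟦X⟧) (C z) (X ^ (2 * N + 1)) (2 * (N + 1))
  have hl : ∏ k ∈ range (2 * (N + 1)), ((X : K⟦X⟧) ^ (2 * N + 1) + C z * (X ^ 2) ^ k) =
      X ^ (3 * (N + 1) * N + (N + 1)) *
      ∏ m ∈ range (N + 1), ((C z + X ^ (2 * m + 1)) * (1 + C z * X ^ (2 * m + 1))) := by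
    rw [two_mul, prod_range_add, prod_mul_distrib]
    have h1 : ∏ k ∈ range (N + 1), ((X : K⟦X⟧) ^ (2 * N + 1) + C z * (X ^ 2) ^ k) =
        X ^ ((N + 1) * N) * ∏ m ∈ range (N + 1), (C z + X ^ (2 * m + 1)) := by
      have hc : (X : K⟦X⟧) ^ ((N + 1) * N) = ∏ k ∈ range (N + 1), X ^ (k * 2) := by
        rw [prod_pow_eq_pow_sum, ← sum_mul, sum_range_id_mul_two, Nat.add_sub_cancel]
      rw [← prod_range_reflect (fun m ↦ C z + (X : K⟦X⟧) ^ (2 * m + 1)),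
        hc, ← prod_mul_distrib]
      refine prod_congr rfl fun k hk ↦ ?_
      rw [mem_range] at hk
      obtain ⟨r, rfl⟩ := Nat.exists_eq_add_of_le (Nat.lt_succ_iff.mp hk)
      have : k + r + 1 - 1 - k = r := by omega
      rw [this]
      ring
    have h2 : ∏ k ∈ range (N + 1), ((X : K⟦X⟧) ^ (2 * N + 1) + C z * (X ^ 2) ^ (N + 1 + k)) =
        X ^ ((2 * N + 1) * (N + 1)) * ∏ m ∈ range (N + 1), (1 + C z * X ^ (2 * m + 1)) := by
      have hc : ((X : K⟦X⟧) ^ ((2 * N + 1) * (N + 1))) = ∏ k ∈ range (N + 1), X ^ (2 * N + 1) := by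
        rw [prod_const, card_range, ← pow_mul]
      rw [hc, ← prod_mul_distrib]
      exact prod_congr rfl fun k hk ↦ by ring
    rw [h1, h2]
    ring
  rw [← hl, key, mul_sum]
  refine sum_congr rfl fun j hj ↦ ?_
  rw [mem_range] at hj
  have he : 2 * j.choose 2 + (2 * N + 1) * (2 * (N + 1) - j) =
      3 * (N + 1) * N + (N + 1) + (((j : ℤ) - (N + 1 : ℕ)) ^ 2).toNat := by
    have hj2 : 2 * j.choose 2 + j = j * j := by
      rw [Nat.choose_two_right, Nat.mul_div_cancel' (Nat.even_mul_pred_self j).two_dvd]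
      cases j <;> simp; ring
    zify [show j ≤ 2 * (N + 1) by omega] at hj2 ⊢
    rw [Int.toNat_of_nonneg (sq_nonneg _)]
    linear_combination hj2
  calc _ = X ^ (2 * j.choose 2 + (2 * N + 1) * (2 * (N + 1) - j)) *
        qBinom (X ^ 2 : K⟦X⟧) (2 * (N + 1)) j * C z ^ j := by ring
    _ = _ := by rw [he]; ring

lemma X_pow_dvd_sum_sub_theta {z : K} (hz : z ≠ 0) (N : ℕ) :
    X ^ N ∣ ∑ j ∈ range (2 * N + 1), X ^ (((j : ℤ) - N) ^ 2).toNat * C z ^ j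
      - C (z ^ N) * theta z := by
  rw [X_pow_dvd_iff]
  intro m hm
  rw [map_sub, map_sum, coeff_C_mul, coeff_theta z hm.le, sub_eq_zero, mul_sum]
  refine sum_bij' (fun j _ ↦ (j : ℤ) - N) (fun n _ ↦ (n + N).toNat) ?_ ?_ ?_ ?_ ?_
  · intro j hj; rw [mem_range] at hj; rw [mem_Icc]; omega
  · intro n hn; rw [mem_Icc] at hn; rw [mem_range]; omega
  · intro j hj; omega
  · intro n hn; rw [mem_Icc] at hn; omega
  · intro j hj
    rw [← map_pow, mul_comm, coeff_C_mul_X_pow]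
    have : m = (((j : ℤ) - N) ^ 2).toNat ↔ ((j : ℤ) - N) ^ 2 = m := by
      have := sq_nonneg ((j : ℤ) - N)
      omega
    simp only [this]
    split_ifs
    · rw [zpow_sub₀ hz, zpow_natCast, zpow_natCast]
      field_simp
    · simp

/-- The Jacobi triple product modulo `X ^ N`. -/
lemma X_pow_dvd_qPoch_mul_prod_sub_theta {z : K} (hz : z ≠ 0) (N : ℕ) :
    X ^ N ∣ qPoch (X ^ 2 : K⟦X⟧) N *
      ∏ m ∈ range N, ((1 + C z⁻¹ * X ^ (2 * m + 1)) * (1 + C z * X ^ (2 * m + 1))) - theta z := by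
  have hu : IsUnit (C (z ^ N) : K⟦X⟧) := (isUnit_iff_ne_zero.mpr (pow_ne_zero N hz)).map C
  rw [← IsUnit.dvd_mul_left hu]
  have hprod : C (z ^ N) *
      ∏ m ∈ range N, ((1 + C z⁻¹ * X ^ (2 * m + 1)) * (1 + C z * X ^ (2 * m + 1))) =
      ∏ m ∈ range N, ((C z + X ^ (2 * m + 1)) * (1 + C z * (X : K⟦X⟧) ^ (2 * m + 1))) := by
    have hc : (C (z ^ N) : K⟦X⟧) = ∏ m ∈ range N, C z := by rw [prod_const, card_range, map_pow]
    rw [hc, ← prod_mul_distrib]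
    refine prod_congr rfl fun m _ ↦ ?_
    have hzz : (C z : K⟦X⟧) * C z⁻¹ = 1 := by rw [← map_mul, mul_inv_cancel₀ hz, map_one]
    linear_combination X ^ (2 * m + 1) * (1 + C z * X ^ (2 * m + 1)) * hzz
  have hsub : ∀ a b c d : K⟦X⟧, c * (a * b - d) = a * (c * b) - c * d := fun a b c d ↦ by ring
  rw [hsub, hprod, prod_eq_sum_qBinom]
  refine (dvd_iff_dvd_of_dvd_sub ?_).mpr (X_pow_dvd_sum_sub_theta hz N)
  rw [sub_sub_sub_cancel_right, mul_sum, ← sum_sub_distrib]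
  refine dvd_sum fun j hj ↦ ?_
  rw [mem_range] at hj
  obtain ⟨b, hb⟩ := Nat.exists_eq_add_of_le (Nat.lt_succ_iff.mp hj)
  obtain ⟨k, hk⟩ : ∃ k, k = min j b := ⟨_, rfl⟩
  have hd := pow_dvd_qPoch_mul_qBinom_sub_one (X ^ 2 : K⟦X⟧) isUnit_qPoch_X_sq
    (show k ≤ j by omega) (show k ≤ b by omega) (show k ≤ N by omega)
  rw [← hb] at hd
  have hN : N ≤ (((j : ℤ) - N) ^ 2).toNat + 2 * (k + 1) := by
    zify
    rw [Int.toNat_of_nonneg (sq_nonneg _)]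
    rcases le_total j b with h | h
    · have hkj : (k : ℤ) = j := by omega
      nlinarith [Int.le_self_sq ((N : ℤ) - j)]
    · have hkj : (k : ℤ) = 2 * N - j := by omega
      nlinarith [Int.le_self_sq ((j : ℤ) - N)]
  have e : qPoch (X ^ 2 : K⟦X⟧) N *
        (X ^ (((j : ℤ) - N) ^ 2).toNat * qBinom (X ^ 2) (2 * N) j * C z ^ j) -
      X ^ (((j : ℤ) - N) ^ 2).toNat * C z ^ j =
      X ^ (((j : ℤ) - N) ^ 2).toNat *
        (qPoch (X ^ 2 : K⟦X⟧) N * qBinom (X ^ 2) (2 * N) j - 1) * C z ^ j := by ring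
  rw [e]
  refine Dvd.dvd.mul_right ((pow_dvd_pow X hN).trans ?_) _
  rw [pow_add, pow_mul]
  exact mul_dvd_mul_left _ hd

lemma tendsto_theta [TopologicalSpace K] {z : K} (hz : z ≠ 0) :
    Tendsto (fun N ↦ qPoch (X ^ 2 : K⟦X⟧) N *
      ∏ m ∈ range N, ((1 + C z⁻¹ * X ^ (2 * m + 1)) * (1 + C z * X ^ (2 * m + 1))))
      atTop (𝓝 (theta z)) :=
  tendsto_of_X_pow_dvd_sub (X_pow_dvd_qPoch_mul_prod_sub_theta hz)

end TripleProduct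

section GeneratingFunction

variable {K : Type*} [Field K]

lemma one_sub_sq_mul_one_add_tsum [TopologicalSpace K] [IsTopologicalRing K] [T2Space K] (i : ℕ) :
    (1 - X ^ (i + 1)) ^ 2 *
      (1 + ∑' j : ℕ, ((j + 1 : ℕ) : K) • (X : K⟦X⟧) ^ ((i + 1) * (j + 1))) =
      1 - X ^ (i + 1) + X ^ (2 * (i + 1)) := by
  have hs := (Nat.Partition.summable_genFun_term (fun _ c ↦ (c : K)) i).hasSum.tendsto_sum_nat
  have hl := hs.const_mul ((1 - (X : K⟦X⟧) ^ (i + 1)) ^ 2)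
  have hpart : ∀ n : ℕ, (1 - (X : K⟦X⟧) ^ (i + 1)) ^ 2 *
      ∑ j ∈ range n, ((j + 1 : ℕ) : K) • (X : K⟦X⟧) ^ ((i + 1) * (j + 1)) - X ^ (i + 1) =
      ((X : K⟦X⟧) ^ (i + 1)) ^ n *
        ((n : K⟦X⟧) * X ^ (2 * (i + 1)) - ((n : K⟦X⟧) + 1) * X ^ (i + 1)) := by
    intro n
    induction n with
    | zero => simp
    | succ n ih =>
      rw [sum_range_succ, mul_add, add_sub_right_comm, ih, Nat.cast_smul_eq_nsmul, nsmul_eq_mul]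
      push_cast
      ring
  have hr : Tendsto (fun n ↦ (1 - (X : K⟦X⟧) ^ (i + 1)) ^ 2 *
      ∑ j ∈ range n, ((j + 1 : ℕ) : K) • (X : K⟦X⟧) ^ ((i + 1) * (j + 1))) atTop
      (𝓝 (X ^ (i + 1))) := by
    refine tendsto_of_X_pow_dvd_sub fun n ↦ ?_
    rw [hpart, ← pow_mul]
    exact Dvd.dvd.mul_right (pow_dvd_pow X (by nlinarith)) _
  have := tendsto_nhds_unique hl hr
  linear_combination this

/-- The weight of a part size occurring with a given multiplicity: the number of choices of a
designated summand, restricted to odd part sizes. -/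
def oddWeight (K : Type*) [Field K] (i c : ℕ) : K := if Odd i then (c : K) else 0

lemma prod_range_two_mul {M : Type*} [CommMonoid M] (f : ℕ → M) (N : ℕ) :
    ∏ i ∈ range (2 * N), f i = ∏ m ∈ range N, (f (2 * m) * f (2 * m + 1)) := by
  induction N with
  | zero => simp
  | succ N ih =>
    rw [Nat.mul_succ, prod_range_succ, prod_range_succ, prod_range_succ, ih, mul_assoc]

lemma genFun_oddWeight_mul_theta [TopologicalSpace K] [IsTopologicalRing K] [T2Space K] {z : K}
    (hz : z ^ 2 + z + 1 = 0) :
    Nat.Partition.genFun (oddWeight K) * theta (-1 : K) = theta z := by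
  have hz0 : z ≠ 0 := by rintro rfl; simp at hz
  have hzi : z⁻¹ + z = -1 := by
    field_simp
    linear_combination hz
  have hF := ((Nat.Partition.hasProd_genFun (oddWeight K)).tendsto_prod_nat.comp
    (tendsto_id.const_mul_atTop' (two_pos (α := ℕ)))).mul
    (tendsto_theta (K := K) (neg_ne_zero.mpr one_ne_zero))
  refine tendsto_nhds_unique hF ((tendsto_theta hz0).congr fun N ↦ ?_)
  simp only [Function.comp_apply, id_eq]
  rw [prod_range_two_mul, mul_left_comm, ← prod_mul_distrib]
  congr 1
  refine prod_congr rfl fun m _ ↦ ?_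
  have hodd : Odd (2 * m + 1) := ⟨m, rfl⟩
  have heven : ¬ Odd (2 * m + 1 + 1) := by simp [Nat.odd_add_one, hodd]
  have hg := one_sub_sq_mul_one_add_tsum (K := K) (2 * m)
  have hC : (C z⁻¹ : K⟦X⟧) + C z = -1 := by rw [← map_add, hzi]; simp
  have hC' : (C z⁻¹ : K⟦X⟧) * C z = 1 := by rw [← map_mul, inv_mul_cancel₀ hz0, map_one]
  simp only [oddWeight, hodd, heven, if_true, if_false, zero_smul, tsum_zero, add_zero, mul_one,
    inv_neg, inv_one, map_neg, map_one]
  linear_combination X ^ (2 * m + 1) * hC + X ^ (2 * (2 * m + 1)) * hC' - hg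

lemma coeff_two_mul_mul_of_coeff_odd_eq_zero {f g : K⟦X⟧} (hg : ∀ k, Odd k → coeff k g = 0)
    (n : ℕ) :
    coeff (2 * n) (f * g) = ∑ p ∈ HasAntidiagonal.antidiagonal n,
      coeff (2 * p.1) f * coeff (2 * p.2) g := by
  rw [coeff_mul]
  symm
  refine sum_of_injOn (fun p ↦ (2 * p.1, 2 * p.2)) ?_ ?_ ?_ ?_
  · rintro ⟨a, b⟩ _ ⟨c, d⟩ _ h
    simp only [Prod.mk.injEq] at h ⊢
    omega
  · rintro ⟨a, b⟩ h
    simp only [mem_coe, HasAntidiagonal.mem_antidiagonal] at h ⊢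
    omega
  · rintro ⟨a, b⟩ h hn
    rw [HasAntidiagonal.mem_antidiagonal] at h
    simp only at h
    rcases Nat.even_or_odd b with hb | hb
    · exfalso
      obtain ⟨d, rfl⟩ := hb
      refine hn ⟨(n - d, d), ?_, ?_⟩
      · simp only [mem_coe, HasAntidiagonal.mem_antidiagonal]; omega
      · simp only [Prod.mk.injEq]; omega
    · simp [hg b hb]
  · intros; rfl

lemma coeff_two_mul_genFun_oddWeight [TopologicalSpace K] [IsTopologicalRing K] [T2Space K]
    [CharZero K] {z : K} (hz : z ^ 2 + z + 1 = 0) (n : ℕ) :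
    coeff (2 * n) (Nat.Partition.genFun (oddWeight K)) =
      coeff n (Nat.Partition.genFun (oddWeight K) * Nat.Partition.genFun (oddWeight K)) := by
  have hz0 : z ≠ 0 := by rintro rfl; simp at hz
  have hF := genFun_oddWeight_mul_theta hz
  set F := Nat.Partition.genFun (oddWeight K)
  have hne : theta (-1 : K) ≠ 0 := by
    intro h
    have := congrArg (coeff 0) h
    simp [theta] at this
  suffices h : PowerSeries.mk (fun n ↦ coeff (2 * n) F) = F * F by
    rw [← h, coeff_mk]
  refine mul_right_cancel₀ (mul_ne_zero hne hne) ?_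
  have hR : F * F * (theta (-1 : K) * theta (-1)) = theta z * theta z := by
    rw [← hF]; ring
  rw [hR]
  ext n
  have h1 := coeff_two_mul_theta_mul_theta hz0 (one_ne_zero (α := K)) n
  rw [mul_one, div_one, ← hF, mul_assoc, mul_comm (theta (-1 : K)),
    coeff_two_mul_mul_of_coeff_odd_eq_zero (fun _ ↦ coeff_odd_theta_one_mul_theta_neg_one), hF]
    at h1
  rw [← h1, coeff_mul]
  refine sum_congr rfl fun p _ ↦ ?_
  rw [coeff_mk, coeff_two_mul_theta_mul_theta one_ne_zero (neg_ne_zero.mpr one_ne_zero)]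
  simp

lemma coeff_genFun_oddWeight (n : ℕ) :
    coeff n (Nat.Partition.genFun (oddWeight K)) =
      ((∑ lam ∈ Finset.univ.filter (fun lam : Nat.Partition n => ∀ i ∈ lam.parts, Odd i),
        ∏ k ∈ lam.parts.toFinset, lam.parts.count k : ℕ) : K) := by
  rw [Nat.Partition.coeff_genFun, sum_filter, Nat.cast_sum]
  refine sum_congr rfl fun lam _ ↦ ?_
  rw [Finsupp.prod, Multiset.toFinsupp_support]
  simp only [Multiset.toFinsupp_apply]
  split_ifs with h
  · rw [Nat.cast_prod]
    exact prod_congr rfl fun k hk ↦ if_pos (h k (Multiset.mem_toFinset.mp hk))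
  · push Not at h
    obtain ⟨i, hi, hodd⟩ := h
    rw [Nat.cast_zero]
    exact prod_eq_zero (Multiset.mem_toFinset.mpr hi) (if_neg hodd)

end GeneratingFunction

end DesignatedSummands

/-- If `PDO n` is the number of partitions of `n` with designated summands in which all
parts are odd, i.e. `PDO n = ∑_λ ∏_k m_k(λ)` where the sum ranges over partitions `λ` of
`n` into odd parts and `m_k(λ)` is the multiplicity of the part size `k` in `λ`, then
`PDO` is `2`-convolutive: `PDO (2n) = ∑_{i=0}^{n} PDO i * PDO (n - i)`. -/
theorem PDO_two_convolutive (PDO : ℕ → ℕ)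
    (hPDO : ∀ n, PDO n =
      ∑ lam ∈ Finset.univ.filter (fun lam : Nat.Partition n => ∀ i ∈ lam.parts, Odd i),
        ∏ k ∈ lam.parts.toFinset, lam.parts.count k) :
    ∀ n, PDO (2 * n) = ∑ i ∈ Finset.range (n + 1), PDO i * PDO (n - i) := by
  intro n
  obtain ⟨z, hz⟩ : ∃ z : ℂ, z ^ 2 + z + 1 = 0 := by
    obtain ⟨s, hs⟩ := IsAlgClosed.exists_pow_nat_eq (-3 : ℂ) two_pos
    exact ⟨(s - 1) / 2, by linear_combination hs / 4⟩
  have hc : ∀ m, PowerSeries.coeff m (Nat.Partition.genFun (DesignatedSummands.oddWeight ℂ)) =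
      (PDO m : ℂ) := fun m ↦ by rw [hPDO, DesignatedSummands.coeff_genFun_oddWeight]
  have h := DesignatedSummands.coeff_two_mul_genFun_oddWeight hz n
  rw [PowerSeries.coeff_mul] at h
  simp only [hc] at h
  rw [Finset.Nat.sum_antidiagonal_eq_sum_range_succ (fun i j ↦ (PDO i : ℂ) * PDO j)] at h
  exact_mod_cast h
end
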